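/- Let 13/14 < γ < 1 be fixed and ε > 0, let α be real and h a positive integer. Let N ≥ 2 and set M = N^{(16−15γ)/29} and ϑ = N^{(2γ+23)/58}. Let m be a positive integer with m ≤ M/2, let N₁ < N₂ ≤ 2N₁ with N^{(30γ−3)/(29γ)} < N₁ ≤ N/2, set f(d,l) = αhd²l² − m d^γ l^γ, and let a(d) be complex numbers with |a(d)| ≤ τ(d), where τ is the number-of-divisors function. Then Θ₄ = Σ_{N₁ < dl ≤ N₂, d > ϑ, l > ϑ} a(d) Λ(l) e(f(d,l)) satisfies Θ₄ ≪ ( N₁^{1/2} ϑ + M^{1/14} N₁^{γ/14 + 6/7} ) N^ε, where Λ is the von Mangoldt function and the implied constant depends only on γ and ε. -/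

import Mathlib

/-- `e2pi x = e^{2πix}`. -/
noncomputable def e2pi (x : ℝ) : ℂ := Complex.exp (2 * Real.pi * Complex.I * x)

section ExponentialBasics

lemma e2pi_add (x y : ℝ) : e2pi (x + y) = e2pi x * e2pi y := by
  simp only [e2pi, ← Complex.exp_add]
  congr 1; push_cast; ring

lemma e2pi_eq_cos_add_sin (x : ℝ) :
    e2pi x = (Real.cos (2 * Real.pi * x) : ℂ) + (Real.sin (2 * Real.pi * x) : ℂ) * Complex.I := by
  rw [e2pi, Complex.ofReal_cos, Complex.ofReal_sin, ← Complex.exp_mul_I]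
  congr 1; push_cast; ring

lemma norm_e2pi (x : ℝ) : ‖e2pi x‖ = 1 := by
  have : (2 * Real.pi * Complex.I * x : ℂ) = ((2 * Real.pi * x : ℝ) : ℂ) * Complex.I := by
    push_cast; ring
  rw [e2pi, this, Complex.norm_exp_ofReal_mul_I]

lemma e2pi_int (b : ℤ) : e2pi b = 1 := by
  rw [e2pi, Complex.exp_eq_one_iff]
  exact ⟨b, by push_cast; ring⟩

lemma conj_e2pi (x : ℝ) : (starRingEnd ℂ) (e2pi x) = e2pi (-x) := by
  rw [e2pi, e2pi, ← Complex.exp_conj]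
  congr 1
  simp only [map_mul, Complex.conj_I, Complex.conj_ofReal, Complex.conj_ofNat]
  push_cast; ring

lemma norm_sum_e2pi_neg {ι : Type*} (s : Finset ι) (f : ι → ℝ) :
    ‖∑ i ∈ s, e2pi (-f i)‖ = ‖∑ i ∈ s, e2pi (f i)‖ := by
  rw [← Complex.norm_conj (∑ i ∈ s, e2pi (f i)), map_sum]
  simp only [conj_e2pi]

lemma norm_sum_e2pi_le {ι : Type*} (s : Finset ι) (f : ι → ℝ) :
    ‖∑ i ∈ s, e2pi (f i)‖ ≤ s.card :=
  (norm_sum_le _ _).trans (by simp [norm_e2pi])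

end ExponentialBasics

section KusminLandau

/-- The reciprocal of `e2pi t - 1`, in terms of `cot (π t)`. -/
lemma inv_coeff_mul (t : ℝ) (ht : Real.sin (Real.pi * t) ≠ 0) :
    (-(1 / 2) - Complex.I / 2 *
      ((Real.cos (Real.pi * t) / Real.sin (Real.pi * t) : ℝ) : ℂ)) * (e2pi t - 1) = 1 := by
  have h2 : 2 * Real.pi * t = 2 * (Real.pi * t) := by ring
  rw [e2pi_eq_cos_add_sin, h2, Real.cos_two_mul, Real.sin_two_mul]
  set C := Real.cos (Real.pi * t)
  set S := Real.sin (Real.pi * t)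
  have hCS : (C : ℂ) ^ 2 = 1 - (S : ℂ) ^ 2 := by
    have := Real.sin_sq_add_cos_sq (Real.pi * t)
    have h : C ^ 2 = 1 - S ^ 2 := by linarith
    exact_mod_cast h
  have hS : (S : ℂ) ≠ 0 := by exact_mod_cast ht
  push_cast
  field_simp
  ring_nf
  simp only [Complex.I_sq]
  have h3 : (C : ℂ) ^ 3 = C * (1 - (S : ℂ) ^ 2) := by rw [← hCS]; ring
  rw [h3, hCS]
  ring

lemma sin_pi_mul_ge {δ t : ℝ} (hδ : 0 < δ) (h1 : δ ≤ t) (h2 : t ≤ 1 - δ) :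
    2 * δ ≤ Real.sin (Real.pi * t) := by
  have hpi := Real.pi_pos
  rcases le_total t (1 / 2) with h | h
  · have := Real.mul_le_sin (x := Real.pi * t) (by nlinarith) (by nlinarith)
    have h3 : 2 / Real.pi * (Real.pi * t) = 2 * t := by field_simp
    linarith
  · have := Real.mul_le_sin (x := Real.pi * (1 - t)) (by nlinarith) (by nlinarith)
    have h3 : 2 / Real.pi * (Real.pi * (1 - t)) = 2 * (1 - t) := by field_simp
    have h4 : Real.sin (Real.pi * (1 - t)) = Real.sin (Real.pi * t) := by
      rw [mul_sub, mul_one, Real.sin_pi_sub]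
    rw [h4] at this
    linarith

lemma cot_antitone {x y : ℝ} (hx : 0 < x) (hxy : x ≤ y) (hy : y < 1) :
    Real.cos (Real.pi * y) / Real.sin (Real.pi * y) ≤
      Real.cos (Real.pi * x) / Real.sin (Real.pi * x) := by
  have hpi := Real.pi_pos
  have s1 : 0 < Real.sin (Real.pi * x) :=
    Real.sin_pos_of_pos_of_lt_pi (by positivity) (by nlinarith)
  have s2 : 0 < Real.sin (Real.pi * y) :=
    Real.sin_pos_of_pos_of_lt_pi (by nlinarith) (by nlinarith)
  rw [div_le_div_iff₀ s2 s1]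
  have : 0 ≤ Real.sin (Real.pi * y - Real.pi * x) :=
    Real.sin_nonneg_of_nonneg_of_le_pi (by nlinarith) (by nlinarith)
  rw [Real.sin_sub] at this
  linarith

/-- **Kusmin–Landau inequality**: an exponential sum whose phase increments are monotone and stay
at distance at least `δ` from the integers is bounded by `2 / δ`. -/
lemma kusmin_landau {g : ℤ → ℝ} {u v b : ℤ} {δ : ℝ} (hδ : 0 < δ)
    (hmono : ∀ n, u ≤ n → n + 1 < v → g (n + 1) - g n ≤ g (n + 2) - g (n + 1))
    (h1 : ∀ n, u ≤ n → n < v → b + δ ≤ g (n + 1) - g n)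
    (h2 : ∀ n, u ≤ n → n < v → g (n + 1) - g n ≤ b + 1 - δ) :
    ‖∑ n ∈ Finset.Ico u v, e2pi (g n)‖ ≤ 2 / δ := by
  rcases le_or_gt v u with huv | huv
  · rw [Finset.Ico_eq_empty (by omega)]; simp; positivity
  set t : ℤ → ℝ := fun n => g (n + 1) - g n - b with ht
  set k : ℤ → ℝ := fun n => Real.cos (Real.pi * t n) / Real.sin (Real.pi * t n) with hk
  set c : ℤ → ℂ := fun n => -(1 / 2) - Complex.I / 2 * (k n : ℂ) with hc
  have ht1 : ∀ n, u ≤ n → n < v → δ ≤ t n := fun n hn hn' => by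
    have := h1 n hn hn'; simp only [ht]; linarith
  have ht2 : ∀ n, u ≤ n → n < v → t n ≤ 1 - δ := fun n hn hn' => by
    have := h2 n hn hn'; simp only [ht]; linarith
  have hsin : ∀ n, u ≤ n → n < v → 2 * δ ≤ Real.sin (Real.pi * t n) := fun n hn hn' =>
    sin_pi_mul_ge hδ (ht1 n hn hn') (ht2 n hn hn')
  have hkabs : ∀ n, u ≤ n → n < v → |k n| ≤ 1 / (2 * δ) := fun n hn hn' => by
    have hs := hsin n hn hn'
    have hspos : 0 < Real.sin (Real.pi * t n) := by linarith
    simp only [hk]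
    rw [abs_div, abs_of_pos hspos]
    exact div_le_div₀ zero_le_one (Real.abs_cos_le_one _) (by positivity) hs
  have hδ2 : δ ≤ 1 / 2 := by
    have a1 := ht1 u le_rfl huv
    have a2 := ht2 u le_rfl huv
    linarith
  have hcnorm : ∀ n, u ≤ n → n < v → ‖c n‖ ≤ 1 / 2 + 1 / 2 * |k n| := fun n _ _ => by
    simp only [hc]
    refine (norm_sub_le _ _).trans ?_
    simp
  have hstep : ∀ n, u ≤ n → n < v → e2pi (g n) = c n * e2pi (g (n + 1)) - c n * e2pi (g n) := by
    intro n hn hn'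
    have hne : Real.sin (Real.pi * t n) ≠ 0 := by have := hsin n hn hn'; linarith
    have key := inv_coeff_mul (t n) hne
    have e1 : e2pi (g (n + 1)) = e2pi (g n) * e2pi (t n) := by
      have : g (n + 1) = g n + t n + b := by simp only [ht]; ring
      rw [this, e2pi_add, e2pi_add, e2pi_int, mul_one]
    rw [e1]
    calc e2pi (g n) = e2pi (g n) * (c n * (e2pi (t n) - 1)) := by rw [key, mul_one]
      _ = _ := by ring
  have hind : ∀ w, u + 1 ≤ w → w ≤ v →
      ‖∑ n ∈ Finset.Ico u w, e2pi (g n) - c (w - 1) * e2pi (g w)‖ ≤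
        ‖c u‖ + (k u - k (w - 1)) / 2 := by
    intro w hw
    induction w, hw using Int.leInduction with
    | base =>
      intro _
      have : Finset.Ico u (u + 1) = {u} := by ext; simp; omega
      rw [this, Finset.sum_singleton, hstep u le_rfl huv]
      simp [norm_e2pi]
    | succ w hw ih =>
      intro hwv
      have ih' := ih (by omega)
      have hsplit : Finset.Ico u (w + 1) = insert w (Finset.Ico u w) := by ext; simp; omega
      have e1 : ∑ n ∈ Finset.Ico u (w + 1), e2pi (g n) - c (w + 1 - 1) * e2pi (g (w + 1)) =
          (∑ n ∈ Finset.Ico u w, e2pi (g n) - c (w - 1) * e2pi (g w)) +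
            (c (w - 1) - c w) * e2pi (g w) := by
        rw [hsplit, Finset.sum_insert (by simp), add_sub_cancel_right]
        linear_combination hstep w (by omega) (by omega)
      have hkk : k w ≤ k (w - 1) := by
        refine cot_antitone ?_ ?_ ?_
        · have := ht1 (w - 1) (by omega) (by omega); linarith
        · have := hmono (w - 1) (by omega) (by omega)
          simp only [ht]
          rw [sub_add_cancel, show w - 1 + 2 = w + 1 by ring] at *
          linarith
        · have := ht2 w (by omega) (by omega); linarith
      have e2 : ‖(c (w - 1) - c w) * e2pi (g w)‖ = (k (w - 1) - k w) / 2 := by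
        have : c (w - 1) - c w = -(Complex.I / 2 * ((k (w - 1) - k w : ℝ) : ℂ)) := by
          simp only [hc]; push_cast; ring
        rw [norm_mul, norm_e2pi, mul_one, this, norm_neg, norm_mul, Complex.norm_real,
          Real.norm_of_nonneg (by linarith)]
        simp; ring
      rw [e1, add_sub_cancel_right]
      refine (norm_add_le _ _).trans ?_
      rw [e2]
      linarith
  have hfin := hind v (by omega) le_rfl
  have a1 := hkabs u le_rfl huv
  have a2 := hkabs (v - 1) (by omega) (by omega)
  have a3 := hcnorm u le_rfl huv
  have a4 := hcnorm (v - 1) (by omega) (by omega)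
  have a5 : ‖∑ n ∈ Finset.Ico u v, e2pi (g n)‖ ≤
      ‖∑ n ∈ Finset.Ico u v, e2pi (g n) - c (v - 1) * e2pi (g v)‖ + ‖c (v - 1)‖ := by
    have := norm_add_le (∑ n ∈ Finset.Ico u v, e2pi (g n) - c (v - 1) * e2pi (g v))
      (c (v - 1) * e2pi (g v))
    rw [sub_add_cancel, norm_mul, norm_e2pi, mul_one] at this
    exact this
  have a6 : 1 / (2 * δ) = 1 / δ / 2 := by field_simp
  have a7 : 2 ≤ 1 / δ := by rw [le_div_iff₀ hδ]; linarith
  have a8 := abs_le.mp a1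
  have a9 := abs_le.mp a2
  rw [a6] at a1 a2
  have a10 : 2 / δ = 2 * (1 / δ) := by ring
  rw [a10]
  linarith [abs_nonneg (k u), abs_nonneg (k (v - 1))]

end KusminLandau

section SecondDifference

lemma exists_monotone_cut (P : ℤ → Prop) {u v : ℤ} (huv : u ≤ v)
    (h : ∀ n, u ≤ n → n + 1 < v → P n → P (n + 1)) :
    ∃ m, u ≤ m ∧ m ≤ v ∧ (∀ n, u ≤ n → n < m → ¬ P n) ∧ ∀ n, m ≤ n → n < v → P n := by
  induction v, huv using Int.leInduction with
  | base => exact ⟨u, le_rfl, le_rfl, fun n _ _ => by omega, fun n _ _ => by omega⟩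
  | succ v huv ih =>
    obtain ⟨m, hm1, hm2, hm3, hm4⟩ := ih fun n h1 h2 => h n h1 (by omega)
    by_cases hP : P v
    · refine ⟨m, hm1, by omega, hm3, fun n h1 h2 => ?_⟩
      rcases eq_or_ne n v with rfl | hne
      · exact hP
      · exact hm4 n h1 (by omega)
    · have hmv : m = v := by
        by_contra hne
        have h1 := h (v - 1) (by omega) (by omega) (hm4 (v - 1) (by omega) (by omega))
        rw [sub_add_cancel] at h1
        exact hP h1
      refine ⟨v + 1, by omega, le_rfl, fun n h1 h2 => ?_, fun n _ _ => by omega⟩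
      rcases eq_or_ne n v with rfl | hne
      · exact hP
      · exact hm3 n h1 (by omega)

lemma mul_le_sub_of_le_increment {s : ℤ → ℝ} {u v : ℤ} {l : ℝ}
    (h : ∀ n, u ≤ n → n + 1 < v → l ≤ s (n + 1) - s n) {p r : ℤ} (hp : u ≤ p) (hpr : p ≤ r)
    (hr : r < v) : l * (r - p) ≤ s r - s p := by
  induction r, hpr using Int.leInduction with
  | base => simp
  | succ r hpr ih =>
    have h1 := ih (by omega)
    have h2 := h r (by omega) (by omega)
    push_cast
    nlinarith

lemma norm_sum_Ico_split (z : ℤ → ℂ) {a m b : ℤ} (h1 : a ≤ m) (h2 : m ≤ b) :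
    ‖∑ n ∈ Finset.Ico a b, z n‖ ≤ ‖∑ n ∈ Finset.Ico a m, z n‖ + ‖∑ n ∈ Finset.Ico m b, z n‖ := by
  rw [← Finset.Ico_union_Ico_eq_Ico h1 h2,
    Finset.sum_union (Finset.Ico_disjoint_Ico_consecutive a m b)]
  exact norm_add_le _ _

/-- **Second derivative test** for a phase whose increments vary by at most `1 / 2`. -/
lemma second_difference_test {g : ℤ → ℝ} {u v : ℤ} {μ x : ℝ} (hμ : 0 < μ) (hμ1 : μ ≤ 1)
    (hinc : ∀ n, u ≤ n → n + 1 < v → μ ≤ (g (n + 2) - g (n + 1)) - (g (n + 1) - g n))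
    (h1 : ∀ n, u ≤ n → n < v → x ≤ g (n + 1) - g n)
    (h2 : ∀ n, u ≤ n → n < v → g (n + 1) - g n ≤ x + 1 / 2) :
    ‖∑ n ∈ Finset.Ico u v, e2pi (g n)‖ ≤ 18 / √μ := by
  have hs : 0 < √μ := Real.sqrt_pos.mpr hμ
  have hs1 : √μ ≤ 1 := Real.sqrt_le_one.mpr hμ1
  have hss : √μ * √μ = μ := Real.mul_self_sqrt hμ.le
  rcases lt_or_ge v u with huv | huv
  · rw [Finset.Ico_eq_empty (by omega)]; simp; positivity
  set b : ℤ := ⌊x + 3 / 4⌋ with hb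
  have hb1 : (b : ℝ) ≤ x + 3 / 4 := Int.floor_le _
  have hb2 : x + 3 / 4 < b + 1 := Int.lt_floor_add_one _
  set δ : ℝ := √μ / 4 with hδ
  have hδ0 : 0 < δ := by positivity
  have hinc' : ∀ n, u ≤ n → n + 1 < v →
      μ ≤ (fun n => g (n + 1) - g n) (n + 1) - (fun n => g (n + 1) - g n) n := by
    intro n hn hn'
    have := hinc n hn hn'
    simp only [show n + 1 + 1 = n + 2 by ring]
    exact this
  have hmono : ∀ n, u ≤ n → n + 1 < v → g (n + 1) - g n ≤ g (n + 2) - g (n + 1) := by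
    intro n hn hn'
    have := hinc n hn hn'
    linarith
  obtain ⟨m₁, a1, a2, a3, a4⟩ := exists_monotone_cut (fun n => b - δ < g (n + 1) - g n) huv
    (fun n hn hn' hP => by
      have := hmono n hn hn'
      simp only [show n + 1 + 1 = n + 2 by ring] at *
      linarith)
  obtain ⟨m₂, b1, b2, b3, b4⟩ := exists_monotone_cut (fun n => b + δ ≤ g (n + 1) - g n) a2
    (fun n hn hn' hP => by
      have := hmono n (by omega) hn'
      simp only [show n + 1 + 1 = n + 2 by ring] at *
      linarith)
  have s1 : ‖∑ n ∈ Finset.Ico u m₁, e2pi (g n)‖ ≤ 2 / δ := by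
    refine kusmin_landau (b := b - 1) hδ0 (fun n hn hn' => hmono n hn (by omega)) ?_ ?_
    · intro n hn hn'
      have := h1 n hn (by omega)
      push_cast
      linarith
    · intro n hn hn'
      have := not_lt.mp (a3 n hn hn')
      push_cast
      linarith
  have s3 : ‖∑ n ∈ Finset.Ico m₂ v, e2pi (g n)‖ ≤ 2 / δ := by
    refine kusmin_landau (b := b) hδ0 (fun n hn hn' => hmono n (by omega) (by omega)) ?_ ?_
    · intro n hn hn'
      exact b4 n hn hn'
    · intro n hn hn'
      have := h2 n (by omega) (by omega)
      linarith
  have s2 : ‖∑ n ∈ Finset.Ico m₁ m₂, e2pi (g n)‖ ≤ 2 * δ / μ + 1 := by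
    refine (norm_sum_e2pi_le _ _).trans ?_
    rcases eq_or_lt_of_le b1 with h | h
    · rw [h]; simp; positivity
    have hcard : ((Finset.Ico m₁ m₂).card : ℝ) = (m₂ : ℝ) - m₁ := by
      rw [Int.card_Ico]
      have : ((m₂ - m₁).toNat : ℤ) = m₂ - m₁ := Int.toNat_of_nonneg (by omega)
      exact_mod_cast this
    rw [hcard]
    have k1 := mul_le_sub_of_le_increment (s := fun n => g (n + 1) - g n) (v := v) hinc'
      (p := m₁) (r := m₂ - 1) a1 (by omega) (by omega)
    have k2 := a4 m₁ le_rfl (by omega)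
    have k3 := not_le.mp (b3 (m₂ - 1) (by omega) (by omega))
    push_cast at k1
    have k4 : (m₂ : ℝ) - 1 - m₁ ≤ 2 * δ / μ := by
      rw [le_div_iff₀ hμ]
      linarith
    linarith
  have t1 := norm_sum_Ico_split (fun n => e2pi (g n)) a1 (b1.trans b2)
  have t2 := norm_sum_Ico_split (fun n => e2pi (g n)) b1 b2
  have e1 : 2 / δ = 8 * (1 / √μ) := by rw [hδ]; field_simp; norm_num
  have e2 : 2 * δ / μ = 1 / 2 * (1 / √μ) := by
    rw [div_eq_iff hμ.ne', hδ]
    have : 1 / √μ * μ = √μ := by rw [one_div, inv_mul_eq_iff_eq_mul₀ hs.ne', hss]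
    linear_combination (-1 / 2 : ℝ) * this
  have e3 : 1 ≤ 1 / √μ := by rw [le_div_iff₀ hs]; linarith
  have e4 : 18 / √μ = 18 * (1 / √μ) := by ring
  rw [e1] at s1 s3
  rw [e2] at s2
  rw [e4]
  linarith

end SecondDifference

section VanDerCorput

lemma sum_comp_le_sum {ι κ : Type*} {A : Finset ι} {B : Finset κ} (T : κ → ℝ) (φ : ι → κ)
    (hT : ∀ k, 0 ≤ T k) (hφ : Set.InjOn φ A) (hAB : ∀ x ∈ A, φ x ∈ B) :
    ∑ x ∈ A, T (φ x) ≤ ∑ k ∈ B, T k := by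
  classical
  rw [← Finset.sum_image (f := T) hφ]
  exact Finset.sum_le_sum_of_subset_of_nonneg (Finset.image_subset_iff.mpr hAB) fun k _ _ => hT k

/-- **Van der Corput's inequality** for an exponential sum over an interval of length at
most `Y`. -/
lemma van_der_corput_ineq (f : ℤ → ℝ) {u v : ℤ} {K : ℕ} {Y : ℝ} (hK : 0 < K) (huv : u ≤ v)
    (hY : ((v - u : ℤ) : ℝ) ≤ Y) :
    ‖∑ n ∈ Finset.Ico u v, e2pi (f n)‖ ^ 2 ≤ (Y + K) / K *
      (Y + 2 * ∑ k ∈ Finset.Ico 1 K,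
        ‖∑ n ∈ Finset.Ico u (v - k), e2pi (f (n + k) - f n)‖) := by
  classical
  set Z : ℤ → ℂ := fun n => if n ∈ Finset.Ico u v then e2pi (f n) else 0 with hZ
  set S := ∑ n ∈ Finset.Ico u v, e2pi (f n) with hS
  set T : ℕ → ℝ := fun k => ‖∑ n ∈ Finset.Ico u (v - k), e2pi (f (n + k) - f n)‖ with hT
  set M := Finset.Ico (u - K) v with hM
  have hshift : ∀ j ∈ Finset.range K, ∑ m ∈ M, Z (m + j) = S := by
    intro j hj
    rw [Finset.mem_range] at hj
    have e1 : ∑ m ∈ M, Z (m + j) = ∑ n ∈ M.map (addRightEmbedding (j : ℤ)), Z n := by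
      rw [Finset.sum_map]; rfl
    rw [e1, hM, Finset.map_add_right_Ico, hS]
    symm
    rw [← Finset.sum_subset (s₁ := Finset.Ico u v) (f := Z)]
    · exact Finset.sum_congr rfl fun n hn => by simp only [hZ]; rw [if_pos hn]
    · intro n hn
      rw [Finset.mem_Ico] at *
      omega
    · intro n _ hn
      simp only [hZ]; rw [if_neg hn]
  have hKS : (K : ℂ) * S = ∑ m ∈ M, ∑ j ∈ Finset.range K, Z (m + j) := by
    rw [Finset.sum_comm, Finset.sum_congr rfl hshift]
    simp
  have hMcard : (M.card : ℝ) ≤ Y + K := by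
    rw [hM, Int.card_Ico]
    have : ((v - (u - K)).toNat : ℤ) = (v - u) + K := by omega
    have h2 : ((v - (u - K)).toNat : ℝ) = ((v - u : ℤ) : ℝ) + K := by exact_mod_cast this
    rw [h2]; linarith
  have hTnn : ∀ k, 0 ≤ T k := fun k => norm_nonneg _
  have hcorr : ∀ i j : ℕ, j < K → i ≤ j →
      ‖∑ m ∈ M, Z (m + j) * (starRingEnd ℂ) (Z (m + i))‖ ≤ if i = j then Y else T (j - i) := by
    intro i j hj hij
    have e1 : ∑ m ∈ M, Z (m + j) * (starRingEnd ℂ) (Z (m + i)) =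
        ∑ n ∈ Finset.Ico u (v - (j - i : ℕ)), e2pi (f (n + (j - i : ℕ)) - f n) := by
      have e2 : ∑ m ∈ M, Z (m + j) * (starRingEnd ℂ) (Z (m + i)) =
          ∑ n ∈ M.map (addRightEmbedding (i : ℤ)),
            Z (n + (j - i : ℕ)) * (starRingEnd ℂ) (Z n) := by
        rw [Finset.sum_map]
        refine Finset.sum_congr rfl fun m _ => ?_
        simp only [addRightEmbedding_apply]
        rw [show m + (i : ℤ) + ((j - i : ℕ) : ℤ) = m + j by omega]
      rw [e2, hM, Finset.map_add_right_Ico]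
      symm
      rw [← Finset.sum_subset (s₁ := Finset.Ico u (v - (j - i : ℕ)))
        (f := fun n => Z (n + (j - i : ℕ)) * (starRingEnd ℂ) (Z n))]
      · refine Finset.sum_congr rfl fun n hn => ?_
        rw [Finset.mem_Ico] at hn
        simp only [hZ]
        rw [if_pos (by rw [Finset.mem_Ico]; omega), if_pos (by rw [Finset.mem_Ico]; omega),
          conj_e2pi, ← e2pi_add, sub_eq_add_neg]
      · intro n hn
        rw [Finset.mem_Ico] at *
        omega
      · intro n _ hn
        rw [Finset.mem_Ico] at hn
        simp only [hZ]
        by_cases h1 : n ∈ Finset.Ico u v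
        · rw [if_neg (by rw [Finset.mem_Ico] at *; omega), zero_mul]
        · rw [if_neg h1, map_zero, mul_zero]
    rw [e1]
    split_ifs with h
    · refine (norm_sum_e2pi_le _ _).trans (le_trans ?_ hY)
      rw [Int.card_Ico]
      have : ((v - (j - i : ℕ) - u).toNat : ℤ) = v - u := by omega
      exact_mod_cast this.le
    · exact le_rfl
  set c : ℕ → ℕ → ℝ := fun i j => if i = j then Y else T (max i j - min i j) with hc
  have hcorr' : ∀ i ∈ Finset.range K, ∀ j ∈ Finset.range K,
      ‖∑ m ∈ M, Z (m + j) * (starRingEnd ℂ) (Z (m + i))‖ ≤ c i j := by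
    intro i hi j hj
    rw [Finset.mem_range] at hi hj
    simp only [hc]
    rcases le_total i j with h | h
    · have := hcorr i j hj h
      rwa [max_eq_right h, min_eq_left h]
    · have := hcorr j i hi h
      rw [max_eq_left h, min_eq_right h, ← Complex.norm_conj, map_sum]
      simp only [map_mul, Complex.conj_conj, eq_comm (a := i)]
      simpa only [mul_comm] using this
  have hrow : ∀ i ∈ Finset.range K, ∑ j ∈ Finset.range K, c i j ≤
      Y + 2 * ∑ k ∈ Finset.Ico 1 K, T k := by
    intro i hi
    rw [Finset.mem_range] at hi
    have e0 : Finset.range K = Finset.range i ∪ ({i} ∪ Finset.Ico (i + 1) K) := by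
      ext x; simp only [Finset.mem_range, Finset.mem_union, Finset.mem_singleton, Finset.mem_Ico]
      omega
    rw [e0, Finset.sum_union, Finset.sum_union, Finset.sum_singleton]
    · have a1 : ∑ j ∈ Finset.range i, c i j ≤ ∑ k ∈ Finset.Ico 1 K, T k := by
        have : ∑ j ∈ Finset.range i, c i j = ∑ j ∈ Finset.range i, T (i - j) := by
          refine Finset.sum_congr rfl fun j hj => ?_
          rw [Finset.mem_range] at hj
          simp only [hc]
          rw [if_neg (by omega), max_eq_left hj.le, min_eq_right hj.le]
        rw [this]
        refine sum_comp_le_sum T (fun j => i - j) hTnn ?_ ?_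
        · intro x hx y hy hxy
          simp only [Finset.coe_range, Set.mem_Iio] at hx hy hxy
          omega
        · intro x hx
          rw [Finset.mem_range] at hx
          rw [Finset.mem_Ico]; omega
      have a2 : ∑ j ∈ Finset.Ico (i + 1) K, c i j ≤ ∑ k ∈ Finset.Ico 1 K, T k := by
        have : ∑ j ∈ Finset.Ico (i + 1) K, c i j = ∑ j ∈ Finset.Ico (i + 1) K, T (j - i) := by
          refine Finset.sum_congr rfl fun j hj => ?_
          rw [Finset.mem_Ico] at hj
          have hij : i ≤ j := by omega
          simp only [hc]
          rw [if_neg (by omega), max_eq_right hij, min_eq_left hij]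
        rw [this]
        refine sum_comp_le_sum T (fun j => j - i) hTnn ?_ ?_
        · intro x hx y hy hxy
          simp only [Finset.coe_Ico, Set.mem_Ico] at hx hy hxy
          omega
        · intro x hx
          rw [Finset.mem_Ico] at *
          omega
      have a3 : c i i = Y := by simp [hc]
      rw [a3]
      linarith
    · rw [Finset.disjoint_left]; intro x hx; simp at hx ⊢; omega
    · rw [Finset.disjoint_left]; intro x hx; simp at hx ⊢; omega
  have hsq : ∑ m ∈ M, ‖∑ j ∈ Finset.range K, Z (m + j)‖ ^ 2 ≤
      K * (Y + 2 * ∑ k ∈ Finset.Ico 1 K, T k) := by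
    have e1 : ((∑ m ∈ M, ‖∑ j ∈ Finset.range K, Z (m + j)‖ ^ 2 : ℝ) : ℂ) =
        ∑ i ∈ Finset.range K, ∑ j ∈ Finset.range K,
          ∑ m ∈ M, Z (m + j) * (starRingEnd ℂ) (Z (m + i)) := by
      push_cast
      rw [Finset.sum_congr rfl fun i _ => Finset.sum_comm, Finset.sum_comm]
      refine Finset.sum_congr rfl fun m _ => ?_
      rw [← Complex.mul_conj', map_sum, Finset.sum_mul_sum, Finset.sum_comm]
    have e2 : ∑ m ∈ M, ‖∑ j ∈ Finset.range K, Z (m + j)‖ ^ 2 ≤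
        ∑ i ∈ Finset.range K, ∑ j ∈ Finset.range K, c i j := by
      rw [← Real.norm_of_nonneg (Finset.sum_nonneg fun m _ => sq_nonneg _), ← Complex.norm_real, e1]
      refine (norm_sum_le _ _).trans (Finset.sum_le_sum fun i hi => ?_)
      exact (norm_sum_le _ _).trans (Finset.sum_le_sum fun j hj => hcorr' i hi j hj)
    refine e2.trans ((Finset.sum_le_sum hrow).trans ?_)
    rw [Finset.sum_const, Finset.card_range, nsmul_eq_mul]
  have hCS : ((K : ℝ) * ‖S‖) ^ 2 ≤ (Y + K) * (K * (Y + 2 * ∑ k ∈ Finset.Ico 1 K, T k)) := by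
    have e1 : (K : ℝ) * ‖S‖ = ‖∑ m ∈ M, ∑ j ∈ Finset.range K, Z (m + j)‖ := by
      rw [← hKS, norm_mul]; simp
    rw [e1]
    calc ‖∑ m ∈ M, ∑ j ∈ Finset.range K, Z (m + j)‖ ^ 2
        ≤ (∑ m ∈ M, ‖∑ j ∈ Finset.range K, Z (m + j)‖) ^ 2 := by
          gcongr; exact norm_sum_le _ _
      _ ≤ M.card * ∑ m ∈ M, ‖∑ j ∈ Finset.range K, Z (m + j)‖ ^ 2 := sq_sum_le_card_mul_sum_sq
      _ ≤ (Y + K) * (K * (Y + 2 * ∑ k ∈ Finset.Ico 1 K, T k)) :=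
          mul_le_mul hMcard hsq (Finset.sum_nonneg fun m _ => sq_nonneg _)
            ((Nat.cast_nonneg _).trans hMcard)
  have hKpos : (0 : ℝ) < K := by exact_mod_cast hK
  rw [div_mul_eq_mul_div, le_div_iff₀ hKpos]
  have : K * (‖S‖ ^ 2 * K) ≤ K * ((Y + K) * (Y + 2 * ∑ k ∈ Finset.Ico 1 K, T k)) := by
    calc K * (‖S‖ ^ 2 * K) = ((K : ℝ) * ‖S‖) ^ 2 := by ring
      _ ≤ _ := hCS
      _ = _ := by ring
  exact le_of_mul_le_mul_left this hKpos

end VanDerCorput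

section ReciprocalDistance

lemma sum_inv_add_inv_reflect_le (q : ℕ) (hq : 0 < q) :
    ∑ r ∈ Finset.Ico 1 q, ((q : ℝ) / r + (q : ℝ) / ((q - r : ℕ) : ℝ)) ≤
      2 * q * (1 + Real.log q) := by
  have hH : ∑ r ∈ Finset.Ico 1 q, (1 : ℝ) / r ≤ 1 + Real.log q := by
    have := harmonic_le_one_add_log q
    refine le_trans ?_ this
    rw [harmonic_eq_sum_Icc]
    push_cast
    simp only [one_div]
    refine Finset.sum_le_sum_of_subset_of_nonneg (fun x hx => ?_) fun _ _ _ => by positivity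
    rw [Finset.mem_Ico] at hx
    rw [Finset.mem_Icc]; omega
  have hR : ∑ r ∈ Finset.Ico 1 q, (1 : ℝ) / ((q - r : ℕ) : ℝ) ≤ 1 + Real.log q := by
    refine le_trans ?_ hH
    refine sum_comp_le_sum (fun k : ℕ => (1 : ℝ) / k) (fun r => q - r) (fun k => by positivity)
      ?_ ?_
    · intro x hx y hy hxy
      simp only [Finset.coe_Ico, Set.mem_Ico] at hx hy hxy
      omega
    · intro x hx
      rw [Finset.mem_Ico] at *
      omega
  have e : ∑ r ∈ Finset.Ico 1 q, ((q : ℝ) / r + (q : ℝ) / ((q - r : ℕ) : ℝ)) =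
      q * (∑ r ∈ Finset.Ico 1 q, (1 : ℝ) / r +
        ∑ r ∈ Finset.Ico 1 q, (1 : ℝ) / ((q - r : ℕ) : ℝ)) := by
    rw [mul_add, Finset.mul_sum, Finset.mul_sum, ← Finset.sum_add_distrib]
    exact Finset.sum_congr rfl fun r _ => by ring
  rw [e]
  have : (0 : ℝ) < q := by exact_mod_cast hq
  nlinarith

/-- The distance of a multiple of a rational number from any integer. -/
lemma inv_dist_rat_mul_le (ρ : ℚ) (k : ℕ) (hk : ¬ ρ.den ∣ k) (b : ℤ) :
    1 / |(k * ρ : ℝ) - b| ≤ (ρ.den : ℝ) / ((k * ρ.num % ρ.den).toNat : ℝ) +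
      (ρ.den : ℝ) / ((ρ.den - (k * ρ.num % ρ.den).toNat : ℕ) : ℝ) ∧
    (k * ρ.num % ρ.den).toNat ∈ Finset.Ico 1 ρ.den := by
  have hq : 0 < ρ.den := ρ.den_pos
  have hq' : (0 : ℝ) < ρ.den := by exact_mod_cast hq
  set r : ℤ := k * ρ.num % ρ.den with hr
  have hr0 : 0 ≤ r := Int.emod_nonneg _ (by omega)
  have hr1 : r < ρ.den := Int.emod_lt_of_pos _ (by omega)
  have hne : r ≠ 0 := by
    intro h
    have h1 : (ρ.den : ℤ) ∣ k * ρ.num := Int.dvd_of_emod_eq_zero h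
    have h2 : IsCoprime (ρ.den : ℤ) ρ.num := by
      rw [Int.isCoprime_iff_nat_coprime]
      simpa using ρ.reduced.symm
    have h3 := h2.dvd_of_dvd_mul_right h1
    exact hk (by exact_mod_cast h3)
  obtain ⟨n, hn⟩ := Int.eq_ofNat_of_zero_le hr0
  rw [hn]
  simp only [Int.toNat_natCast]
  have hn1 : 1 ≤ n := by omega
  have hn2 : n < ρ.den := by omega
  refine ⟨?_, Finset.mem_Ico.mpr ⟨hn1, hn2⟩⟩
  have hn1' : (0 : ℝ) < n := by exact_mod_cast hn1
  have hn2' : (0 : ℝ) < ρ.den - n := by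
    have : (n : ℝ) < ρ.den := by exact_mod_cast hn2
    linarith
  have hdm := Int.emod_add_mul_ediv (k * ρ.num) ρ.den
  rw [← hr, hn] at hdm
  set z : ℤ := k * ρ.num / ρ.den
  have hk' : (k : ℝ) * (ρ : ℝ) = n / ρ.den + z := by
    have h1 : (ρ : ℝ) = ρ.num / ρ.den := by exact_mod_cast (Rat.num_div_den ρ).symm
    have h2 : (k : ℝ) * ρ.num = n + ρ.den * z := by exact_mod_cast hdm.symm
    rw [h1, mul_div_assoc', h2]
    field_simp
  rw [hk', Nat.cast_sub hn2.le]
  have p1 : 0 ≤ (ρ.den : ℝ) / n := by positivity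
  have p2 : 0 ≤ (ρ.den : ℝ) / (ρ.den - n) := by positivity
  rcases le_or_gt b z with hbz | hbz
  · have hb' : (b : ℝ) ≤ z := by exact_mod_cast hbz
    have : (n : ℝ) / ρ.den ≤ |(n : ℝ) / ρ.den + z - b| := by
      refine le_trans ?_ (le_abs_self _); linarith
    have h3 : 1 / |(n : ℝ) / ρ.den + z - b| ≤ 1 / ((n : ℝ) / ρ.den) :=
      one_div_le_one_div_of_le (by positivity) this
    rw [one_div_div] at h3
    linarith
  · have hb' : (z : ℝ) + 1 ≤ b := by exact_mod_cast hbz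
    have e : ((ρ.den : ℝ) - n) / ρ.den = 1 - n / ρ.den := by
      rw [sub_div, div_self hq'.ne']
    have : ((ρ.den : ℝ) - n) / ρ.den ≤ |(n : ℝ) / ρ.den + z - b| := by
      rw [abs_sub_comm, e]
      refine le_trans ?_ (le_abs_self _); linarith
    have h3 : 1 / |(n : ℝ) / ρ.den + z - b| ≤ 1 / (((ρ.den : ℝ) - n) / ρ.den) :=
      one_div_le_one_div_of_le (by positivity) this
    rw [one_div_div] at h3
    linarith

lemma sum_inv_dist_rat_mul_le (ρ : ℚ) (K : ℕ) :
    ∑ k ∈ (Finset.Ico 1 K).filter (fun k => ¬ ρ.den ∣ k), 1 / |(k * ρ : ℝ) - round (k * ρ : ℝ)| ≤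
      (K / ρ.den + 1) * (2 * ρ.den * (1 + Real.log ρ.den)) := by
  have hq : 0 < ρ.den := ρ.den_pos
  have hq' : (0 : ℝ) < ρ.den := by exact_mod_cast hq
  set q := ρ.den with hqdef
  set A := (Finset.Ico 1 K).filter (fun k => ¬ q ∣ k) with hA
  set T : ℕ → ℝ := fun r => (q : ℝ) / r + (q : ℝ) / ((q - r : ℕ) : ℝ) with hT
  set φ : ℕ → ℕ := fun k => (k * ρ.num % q).toNat with hφ
  have hmem : ∀ k ∈ A, ¬ q ∣ k := fun k hk => (Finset.mem_filter.mp hk).2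
  have h1 : ∑ k ∈ A, 1 / |(k * ρ : ℝ) - round (k * ρ : ℝ)| ≤ ∑ k ∈ A, T (φ k) :=
    Finset.sum_le_sum fun k hk => (inv_dist_rat_mul_le ρ k (hmem k hk) _).1
  have hmaps : ∀ k ∈ A, k / q ∈ Finset.range (K / q + 1) := by
    intro k hk
    have := (Finset.mem_Ico.mp (Finset.mem_filter.mp hk).1).2
    rw [Finset.mem_range]
    exact Nat.lt_succ_of_le (Nat.div_le_div_right this.le)
  refine h1.trans ?_
  rw [← Finset.sum_fiberwise_of_maps_to hmaps]
  have h2 : ∀ j ∈ Finset.range (K / q + 1), ∑ k ∈ A.filter (fun k => k / q = j), T (φ k) ≤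
      2 * q * (1 + Real.log q) := by
    intro j _
    refine le_trans ?_ (sum_inv_add_inv_reflect_le q hq)
    refine sum_comp_le_sum T φ (fun r => by positivity) ?_ ?_
    · intro x hx y hy hxy
      simp only [Finset.coe_filter, Set.mem_ofPred_eq] at hx hy
      have hxq := (inv_dist_rat_mul_le ρ x (hmem x hx.1) 0).2
      have hyq := (inv_dist_rat_mul_le ρ y (hmem y hy.1) 0).2
      have hxy' : x * ρ.num % q = y * ρ.num % q := by
        have a1 : 0 ≤ x * ρ.num % (q : ℤ) := Int.emod_nonneg _ (by omega)
        have a2 : 0 ≤ y * ρ.num % (q : ℤ) := Int.emod_nonneg _ (by omega)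
        simp only [hφ] at hxy
        omega
      have h3 : (q : ℤ) ∣ x * ρ.num - y * ρ.num := 
        Int.dvd_of_emod_eq_zero (Int.emod_eq_emod_iff_emod_sub_eq_zero.mp hxy')
      rw [← sub_mul] at h3
      have h4 : IsCoprime (q : ℤ) ρ.num := by
        rw [Int.isCoprime_iff_nat_coprime]
        simpa using ρ.reduced.symm
      have h5 := h4.dvd_of_dvd_mul_right h3
      have h6 : x % q = y % q := by
        have h7 : (x : ℤ) % q = y % q := Int.emod_eq_emod_iff_emod_sub_eq_zero.mpr
          (Int.emod_eq_zero_of_dvd h5)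
        exact_mod_cast h7
      rw [← Nat.div_add_mod x q, ← Nat.div_add_mod y q, hx.2, hy.2, h6]
    · intro x hx
      exact (inv_dist_rat_mul_le ρ x (hmem x (Finset.mem_filter.mp hx).1) 0).2
  refine (Finset.sum_le_sum h2).trans ?_
  rw [Finset.sum_const, Finset.card_range, nsmul_eq_mul]
  have hlog : 0 ≤ Real.log q := Real.log_natCast_nonneg q
  push_cast
  have : ((K / q : ℕ) : ℝ) ≤ K / q := Nat.cast_div_le
  gcongr

end ReciprocalDistance

section Shell

/-- The second forward difference. -/
def secondDiff (f : ℤ → ℝ) (n : ℤ) : ℝ := f (n + 2) - 2 * f (n + 1) + f n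

lemma sum_secondDiff (f : ℤ → ℝ) (n : ℤ) (k : ℕ) :
    ∑ j ∈ Finset.range k, secondDiff f (n + j) =
      (f (n + 1 + k) - f (n + 1)) - (f (n + k) - f n) := by
  induction k with
  | zero => simp
  | succ k ih =>
    rw [Finset.sum_range_succ, ih, secondDiff]
    push_cast
    rw [show n + (k : ℤ) + 2 = n + 1 + (k + 1) by ring, show n + (k : ℤ) + 1 = n + 1 + k by ring,
      show n + ((k : ℤ) + 1) = n + 1 + k by ring]
    ring

lemma one_div_den_le_abs_sub (ρ : ℚ) (k : ℕ) (hk : ¬ ρ.den ∣ k) (b : ℤ) :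
    1 / (ρ.den : ℝ) ≤ |(k * ρ : ℝ) - b| := by
  have hq' : (0 : ℝ) < ρ.den := by exact_mod_cast ρ.den_pos
  have h1 : (ρ : ℝ) = ρ.num / ρ.den := by exact_mod_cast (Rat.num_div_den ρ).symm
  have h2 : (k * ρ : ℝ) - b = ((k * ρ.num - b * ρ.den : ℤ) : ℝ) / ρ.den := by
    rw [h1]; push_cast; field_simp
  have hne : (k * ρ.num - b * ρ.den : ℤ) ≠ 0 := by
    intro h
    have h3 : (ρ.den : ℤ) ∣ k * ρ.num := ⟨b, by linarith⟩
    have h4 : IsCoprime (ρ.den : ℤ) ρ.num := by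
      rw [Int.isCoprime_iff_nat_coprime]
      simpa using ρ.reduced.symm
    exact hk (by exact_mod_cast h4.dvd_of_dvd_mul_right h3)
  rw [h2, abs_div, abs_of_pos hq']
  gcongr
  exact_mod_cast Int.one_le_abs hne

/-- A shifted difference sum whose second difference stays on one side of a rational point `ρ`,
for a shift `k` divisible by the denominator. -/
lemma norm_shift_sum_le_of_dvd {f : ℤ → ℝ} {u v : ℤ} {k : ℕ} {x δ lam : ℝ} (b : ℤ)
    (hx : x = b) (hδ : 0 < δ) (hlam : 0 ≤ lam)
    (hinc : ∀ n, u ≤ n → n + 1 < v - k → lam ≤ secondDiff f (n + k) - secondDiff f n)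
    (hside : (∀ n, u ≤ n → n < v - k →
        x + δ ≤ (f (n + 1 + k) - f (n + 1)) - (f (n + k) - f n) ∧
        (f (n + 1 + k) - f (n + 1)) - (f (n + k) - f n) ≤ x + (1 - δ)) ∨
      (∀ n, u ≤ n → n < v - k →
        x - (1 - δ) ≤ (f (n + 1 + k) - f (n + 1)) - (f (n + k) - f n) ∧
        (f (n + 1 + k) - f (n + 1)) - (f (n + k) - f n) ≤ x - δ)) :
    ‖∑ n ∈ Finset.Ico u (v - k), e2pi (f (n + k) - f n)‖ ≤ 2 / δ := by
  have hmono : ∀ n, u ≤ n → n + 1 < v - k →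
      (f (n + 1 + k) - f (n + 1)) - (f (n + k) - f n) ≤
        (f (n + 2 + k) - f (n + 2)) - (f (n + 1 + k) - f (n + 1)) := by
    intro n h1 h2
    have := hinc n h1 h2
    simp only [secondDiff] at this
    rw [show n + (k : ℤ) + 2 = n + 2 + k by ring, show n + (k : ℤ) + 1 = n + 1 + k by ring] at this
    linarith
  rcases hside with h | h
  · refine kusmin_landau (g := fun n => f (n + k) - f n) (b := b) hδ hmono ?_ ?_
    · intro n h1 h2
      have := (h n h1 h2).1
      rwa [hx] at this
    · intro n h1 h2
      have := (h n h1 h2).2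
      rw [hx] at this
      linarith
  · refine kusmin_landau (g := fun n => f (n + k) - f n) (b := b - 1) hδ hmono ?_ ?_
    · intro n h1 h2
      have := (h n h1 h2).1
      rw [hx] at this
      push_cast
      linarith
    · intro n h1 h2
      have := (h n h1 h2).2
      rw [hx] at this
      push_cast
      linarith

/-- Exponential sums over a range where the second difference lies on one side of a rational
point `ρ`, at distance of exact order `lam * Y`. -/
lemma shell_bound {f : ℤ → ℝ} {u v : ℤ} {K : ℕ} {c lam Y : ℝ} {ρ : ℚ} (hc : 1 ≤ c)
    (hlam : 0 < lam) (hK : 0 < K) (hK3 : (K : ℝ) ^ 3 * lam ≤ 1) (hq : ρ.den ≤ 8 * K)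
    (hKY : (K : ℝ) ≤ Y) (hY : ((v - u : ℤ) : ℝ) ≤ Y) (hcY : c * lam * Y * K ≤ 1 / 8)
    (hinc : ∀ n, u ≤ n → n + 1 < v → lam ≤ secondDiff f (n + 1) - secondDiff f n)
    (hside : (∀ n, u ≤ n → n < v → lam * Y ≤ secondDiff f n - ρ ∧
        secondDiff f n - ρ ≤ 1 / (8 * K * ρ.den) + c * lam * Y) ∨
      (∀ n, u ≤ n → n < v → lam * Y ≤ ρ - secondDiff f n ∧
        ρ - secondDiff f n ≤ 1 / (8 * K * ρ.den) + c * lam * Y)) :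
    ‖∑ n ∈ Finset.Ico u v, e2pi (f n)‖ ^ 2 ≤
      6000 * c * (1 + Real.log (8 * K)) * (Y ^ 2 / K + 1 / (K * lam)) := by
  have hK' : (1 : ℝ) ≤ K := by exact_mod_cast hK
  have hK0 : (0 : ℝ) < K := by linarith
  have hY0 : 0 < Y := by linarith
  have hqpos : (0 : ℝ) < ρ.den := by exact_mod_cast ρ.den_pos
  have hq1 : (1 : ℝ) ≤ ρ.den := by exact_mod_cast ρ.den_pos
  have hq8 : (ρ.den : ℝ) ≤ 8 * K := by exact_mod_cast hq
  set L := 1 + Real.log (8 * K) with hL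
  have hL1 : 1 ≤ L := by
    have : 0 ≤ Real.log (8 * K) := Real.log_nonneg (by linarith)
    linarith
  have hL0 : 0 < L := by linarith
  rcases lt_or_ge v u with huv | huv
  · rw [Finset.Ico_eq_empty (by omega)]
    rw [Finset.sum_empty, norm_zero, zero_pow two_ne_zero]
    positivity
  set T : ℕ → ℝ := fun k => ‖∑ n ∈ Finset.Ico u (v - k), e2pi (f (n + k) - f n)‖ with hT
  -- increments of the shifted differences
  have hincK : ∀ k : ℕ, ∀ n, u ≤ n → n + 1 < v - k →
      k * lam ≤ secondDiff f (n + k) - secondDiff f n := by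
    intro k n h1 h2
    have := mul_le_sub_of_le_increment (s := secondDiff f) hinc (p := n) (r := n + k) h1 (by omega)
      (by omega)
    push_cast at this
    linarith
  have hsum : ∀ k : ℕ, k < K → (∀ n, u ≤ n → n < v - k →
        k * (lam * Y) ≤ ((f (n + 1 + k) - f (n + 1)) - (f (n + k) - f n)) - k * ρ ∧
        ((f (n + 1 + k) - f (n + 1)) - (f (n + k) - f n)) - k * ρ ≤
          1 / (8 * ρ.den) + k * (c * lam * Y)) ∨
      (∀ n, u ≤ n → n < v - k →
        k * (lam * Y) ≤ k * ρ - ((f (n + 1 + k) - f (n + 1)) - (f (n + k) - f n)) ∧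
        k * ρ - ((f (n + 1 + k) - f (n + 1)) - (f (n + k) - f n)) ≤
          1 / (8 * ρ.den) + k * (c * lam * Y)) := by
    intro k hk
    have hkK : (k : ℝ) ≤ K := by exact_mod_cast hk.le
    have hfrac : (k : ℝ) * (1 / (8 * K * ρ.den)) ≤ 1 / (8 * ρ.den) := by
      calc (k : ℝ) * (1 / (8 * K * ρ.den)) ≤ K * (1 / (8 * K * ρ.den)) := by gcongr
        _ = 1 / (8 * ρ.den) := by field_simp
    refine hside.imp (fun h n h1 h2 => ?_) (fun h n h1 h2 => ?_)
    · have e : ((f (n + 1 + k) - f (n + 1)) - (f (n + k) - f n)) - k * ρ =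
          ∑ j ∈ Finset.range k, (secondDiff f (n + j) - ρ) := by
        rw [Finset.sum_sub_distrib, sum_secondDiff]; simp
      have hb : ∀ j ∈ Finset.range k, lam * Y ≤ secondDiff f (n + j) - ρ ∧
          secondDiff f (n + j) - ρ ≤ 1 / (8 * K * ρ.den) + c * lam * Y := by
        intro j hj
        rw [Finset.mem_range] at hj
        exact h _ (by omega) (by omega)
      rw [e]
      have a1 := Finset.card_nsmul_le_sum _ _ _ fun j hj => (hb j hj).1
      have a2 := Finset.sum_le_card_nsmul _ _ _ fun j hj => (hb j hj).2
      rw [Finset.card_range, nsmul_eq_mul] at a1 a2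
      exact ⟨a1, by linarith⟩
    · have e : k * ρ - ((f (n + 1 + k) - f (n + 1)) - (f (n + k) - f n)) =
          ∑ j ∈ Finset.range k, (ρ - secondDiff f (n + j)) := by
        rw [Finset.sum_sub_distrib, sum_secondDiff]; simp
      have hb : ∀ j ∈ Finset.range k, lam * Y ≤ ρ - secondDiff f (n + j) ∧
          ρ - secondDiff f (n + j) ≤ 1 / (8 * K * ρ.den) + c * lam * Y := by
        intro j hj
        rw [Finset.mem_range] at hj
        exact h _ (by omega) (by omega)
      rw [e]
      have a1 := Finset.card_nsmul_le_sum _ _ _ fun j hj => (hb j hj).1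
      have a2 := Finset.sum_le_card_nsmul _ _ _ fun j hj => (hb j hj).2
      rw [Finset.card_range, nsmul_eq_mul] at a1 a2
      exact ⟨a1, by linarith⟩
  have hsmall : ∀ k : ℕ, k < K → (k : ℝ) * (c * lam * Y) ≤ 1 / 8 ∧
      (k : ℝ) * (lam * Y) ≤ 1 / 8 := by
    intro k hk
    have hkK : (k : ℝ) ≤ K := by exact_mod_cast hk.le
    have h1 : (k : ℝ) * (c * lam * Y) ≤ 1 / 8 := by
      calc (k : ℝ) * (c * lam * Y) ≤ K * (c * lam * Y) := by gcongr
        _ ≤ 1 / 8 := by linarith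
    refine ⟨h1, le_trans ?_ h1⟩
    have : lam * Y ≤ c * lam * Y := by
      rw [mul_assoc]; exact le_mul_of_one_le_left (by positivity) hc
    gcongr
  have hq18 : 1 / (8 * (ρ.den : ℝ)) ≤ 1 / 8 := by
    apply one_div_le_one_div_of_le <;> linarith
  have hdvd : ∀ k ∈ Finset.Ico 1 K, ρ.den ∣ k → T k ≤ 2 / (lam * Y) * (1 / k) := by
    intro k hk hqk
    rw [Finset.mem_Ico] at hk
    have hk0 : (0 : ℝ) < k := by exact_mod_cast hk.1
    obtain ⟨d, hd⟩ := hqk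
    obtain ⟨s1, s2⟩ := hsmall k hk.2
    have hx : (k : ℝ) * ρ = (d * ρ.num : ℤ) := by
      have h1 : (ρ : ℝ) = ρ.num / ρ.den := by exact_mod_cast (Rat.num_div_den ρ).symm
      rw [h1, hd]; push_cast; field_simp
    have e : 2 / (lam * Y) * (1 / k) = 2 / (k * (lam * Y)) := by field_simp
    rw [e]
    refine norm_shift_sum_le_of_dvd (lam := k * lam) _ hx (by positivity)
      (by positivity) (hincK k) ((hsum k hk.2).imp (fun h n h1 h2 => ?_) (fun h n h1 h2 => ?_))
    · obtain ⟨b1, b2⟩ := h n h1 h2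
      constructor <;> linarith
    · obtain ⟨b1, b2⟩ := h n h1 h2
      constructor <;> linarith
  have hndvd : ∀ k ∈ Finset.Ico 1 K, ¬ ρ.den ∣ k →
      T k ≤ 72 * c * (Y / K) * (1 / |(k * ρ : ℝ) - round (k * ρ : ℝ)|) := by
    intro k hk hqk
    rw [Finset.mem_Ico] at hk
    have hk0 : (0 : ℝ) < k := by exact_mod_cast hk.1
    have hkK : (k : ℝ) ≤ K := by exact_mod_cast hk.2.le
    obtain ⟨s1, s2⟩ := hsmall k hk.2
    have s0 : 0 ≤ (k : ℝ) * (lam * Y) := by positivity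
    set x : ℝ := k * ρ with hx
    set b : ℤ := round x with hb
    set t := |x - b| with ht
    have ht1 : 1 / (ρ.den : ℝ) ≤ t := one_div_den_le_abs_sub ρ k hqk b
    have ht2 : t ≤ 1 / 2 := abs_sub_round x
    have ht0 : 0 < t := lt_of_lt_of_le (by positivity) ht1
    have hq8' : 1 / (8 * (ρ.den : ℝ)) ≤ t / 8 := by
      have : 1 / (8 * (ρ.den : ℝ)) = 1 / (ρ.den : ℝ) / 8 := by field_simp
      rw [this]; linarith
    have hYK : 1 ≤ Y / K := by rw [le_div_iff₀ hK0]; linarith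
    rcases le_or_gt (k * (c * lam * Y)) (t / 4) with hsm | hbig
    · have habs : ∀ n, u ≤ n → n < v - k →
          |((f (n + 1 + k) - f (n + 1)) - (f (n + k) - f n)) - x| ≤ t / 2 := by
        intro n h1 h2
        rw [abs_le]
        rcases hsum k hk.2 with h | h
        · obtain ⟨b1, b2⟩ := h n h1 h2
          constructor <;> linarith
        · obtain ⟨b1, b2⟩ := h n h1 h2
          constructor <;> linarith
      have h4 : T k ≤ 2 / (t / 2) := by
        refine norm_shift_sum_le_of_dvd (x := b) (lam := k * lam) b rfl (by positivity)
          (by positivity) (hincK k) ?_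
        rcases le_total 0 (x - b) with hs | hs
        · left
          intro n h1 h2
          have := abs_le.mp (habs n h1 h2)
          have e : t = x - b := abs_of_nonneg hs
          constructor <;> linarith [this.1, this.2]
        · right
          intro n h1 h2
          have := abs_le.mp (habs n h1 h2)
          have e : t = -(x - b) := abs_of_nonpos hs
          constructor <;> linarith [this.1, this.2]
      calc T k ≤ 2 / (t / 2) := h4
        _ = 4 * 1 * (1 / t) := by field_simp; norm_num
        _ ≤ (72 * c) * (Y / K) * (1 / t) := by gcongr; linarith
        _ = _ := by ring
    · have hkl : 0 < k * lam := by positivity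
      have hK2 : K * lam ≤ (1 / K) ^ 2 := by
        rw [one_div, inv_pow, ← one_div, le_div_iff₀ (by positivity)]
        calc (K : ℝ) * lam * K ^ 2 = K ^ 3 * lam := by ring
          _ ≤ 1 := hK3
      have hsq : √(k * lam) ≤ 1 / K := by
        refine (Real.sqrt_le_sqrt (by gcongr)).trans ((Real.sqrt_le_sqrt hK2).trans ?_)
        rw [Real.sqrt_sq (by positivity)]
      have hkl1 : k * lam ≤ 1 := by
        calc (k : ℝ) * lam ≤ K * lam := by gcongr
          _ ≤ (1 / K) ^ 2 := hK2
          _ ≤ 1 := by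
            refine pow_le_one₀ (by positivity) ?_
            rw [div_le_one hK0]; exact hK'
      have hspos : 0 < √(k * lam) := Real.sqrt_pos.mpr hkl
      have h18 : T k ≤ 18 / √(k * lam) := by
        have hinc2 : ∀ n, u ≤ n → n + 1 < v - k →
            k * lam ≤ ((f (n + 2 + k) - f (n + 2)) - (f (n + 1 + k) - f (n + 1))) -
              ((f (n + 1 + k) - f (n + 1)) - (f (n + k) - f n)) := by
          intro n h1 h2
          have := hincK k n h1 h2
          simp only [secondDiff] at this
          rw [show n + (k : ℤ) + 2 = n + 2 + k by ring,
            show n + (k : ℤ) + 1 = n + 1 + k by ring] at this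
          linarith
        rcases hsum k hk.2 with h | h
        · refine second_difference_test (g := fun n => f (n + k) - f n) (x := x) hkl hkl1 hinc2
            ?_ ?_
          · intro n h1 h2
            have := (h n h1 h2).1
            linarith
          · intro n h1 h2
            have := (h n h1 h2).2
            linarith
        · refine second_difference_test (g := fun n => f (n + k) - f n) (x := x - 1 / 2)
            hkl hkl1 hinc2 ?_ ?_
          · intro n h1 h2
            have := (h n h1 h2).2
            linarith
          · intro n h1 h2
            have := (h n h1 h2).1
            linarith
      have hone : 1 ≤ 4 * (k * (c * lam * Y)) * (1 / t) := by
        rw [mul_one_div, le_div_iff₀ ht0]; linarith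
      calc T k ≤ 18 / √(k * lam) := h18
        _ ≤ 18 / √(k * lam) * (4 * (k * (c * lam * Y)) * (1 / t)) :=
          le_mul_of_one_le_right (by positivity) hone
        _ = 72 * c * Y * ((k * lam) / √(k * lam)) * (1 / t) := by ring
        _ = 72 * c * Y * √(k * lam) * (1 / t) := by rw [Real.div_sqrt]
        _ ≤ 72 * c * Y * (1 / K) * (1 / t) := by gcongr
        _ = _ := by ring
  have hT_sum : ∑ k ∈ Finset.Ico 1 K, T k ≤ 2 / (lam * Y) * L + 1296 * c * Y * L := by
    rw [← Finset.sum_filter_add_sum_filter_not (Finset.Ico 1 K) (fun k => ρ.den ∣ k)]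
    refine add_le_add ?_ ?_
    · have h1 : ∑ k ∈ (Finset.Ico 1 K).filter (fun k => ρ.den ∣ k), T k ≤
          2 / (lam * Y) * ∑ k ∈ Finset.Ico 1 K, 1 / (k : ℝ) := by
        rw [Finset.mul_sum]
        calc ∑ k ∈ (Finset.Ico 1 K).filter (fun k => ρ.den ∣ k), T k
            ≤ ∑ k ∈ (Finset.Ico 1 K).filter (fun k => ρ.den ∣ k), 2 / (lam * Y) * (1 / (k : ℝ)) :=
              Finset.sum_le_sum fun k hk => by
                rw [Finset.mem_filter] at hk
                exact hdvd k hk.1 hk.2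
          _ ≤ _ := Finset.sum_le_sum_of_subset_of_nonneg (Finset.filter_subset _ _)
              fun k _ _ => by positivity
      refine h1.trans ?_
      gcongr
      have h2 : ∑ k ∈ Finset.Ico 1 K, 1 / (k : ℝ) ≤ 1 + Real.log K := by
        refine le_trans ?_ (harmonic_le_one_add_log K)
        rw [harmonic_eq_sum_Icc]
        push_cast
        simp only [one_div]
        refine Finset.sum_le_sum_of_subset_of_nonneg (fun x hx => ?_) fun _ _ _ => by positivity
        rw [Finset.mem_Ico] at hx
        rw [Finset.mem_Icc]; omega
      refine h2.trans ?_
      have := Real.log_le_log hK0 (show (K : ℝ) ≤ 8 * K by linarith)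
      linarith
    · calc ∑ k ∈ (Finset.Ico 1 K).filter (fun k => ¬ ρ.den ∣ k), T k
          ≤ ∑ k ∈ (Finset.Ico 1 K).filter (fun k => ¬ ρ.den ∣ k),
              72 * c * (Y / K) * (1 / |(k * ρ : ℝ) - round (k * ρ : ℝ)|) :=
            Finset.sum_le_sum fun k hk => by
              rw [Finset.mem_filter] at hk
              exact hndvd k hk.1 hk.2
        _ ≤ 72 * c * (Y / K) * ((K / ρ.den + 1) * (2 * ρ.den * (1 + Real.log ρ.den))) := by
            rw [← Finset.mul_sum]
            gcongr
            exact sum_inv_dist_rat_mul_le ρ K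
        _ = 144 * c * (Y / K) * (K + ρ.den) * (1 + Real.log ρ.den) := by field_simp; ring
        _ ≤ 144 * c * (Y / K) * (K + 8 * K) * L := by
            have := Real.log_le_log hqpos hq8
            have h0 : 0 ≤ Real.log ρ.den := Real.log_nonneg hq1
            gcongr
            linarith
        _ = 1296 * c * Y * L := by field_simp; norm_num
  have hvdc := van_der_corput_ineq f hK huv hY
  refine hvdc.trans ?_
  calc (Y + K) / K * (Y + 2 * ∑ k ∈ Finset.Ico 1 K, T k)
      ≤ (Y + Y) / K * (c * L * Y + 2 * (2 / (lam * Y) * L + 1296 * c * Y * L)) := by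
        have h0 : 0 ≤ ∑ k ∈ Finset.Ico 1 K, T k := Finset.sum_nonneg fun k _ => norm_nonneg _
        have h1 : Y ≤ c * L * Y := by
          have : 1 ≤ c * L := one_le_mul_of_one_le_of_one_le hc hL1
          exact le_mul_of_one_le_left hY0.le this
        gcongr
    _ = 5186 * c * L * (Y ^ 2 / K) + 8 * 1 * L * (1 / (K * lam)) := by field_simp; ring
    _ ≤ 6000 * c * L * (Y ^ 2 / K) + 6000 * c * L * (1 / (K * lam)) := by
        gcongr
        · norm_num
        · norm_num
    _ = _ := by ring

end Shell

section Chunk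

lemma exists_two_pow_ge {x : ℝ} (hx : 1 ≤ x) :
    ∃ J : ℕ, x ≤ 2 ^ J ∧ (J : ℝ) ≤ 1 + 2 * Real.log x := by
  have hl2 : (0 : ℝ) < Real.log 2 := Real.log_pos (by norm_num)
  have hlx : 0 ≤ Real.log x := Real.log_nonneg hx
  refine ⟨⌈Real.log x / Real.log 2⌉₊, ?_, ?_⟩
  · rw [← Real.rpow_natCast]
    calc x = (2 : ℝ) ^ (Real.log x / Real.log 2) := by
          rw [Real.rpow_def_of_pos (by norm_num), mul_div_cancel₀ _ hl2.ne',
            Real.exp_log (by linarith)]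
      _ ≤ _ := Real.rpow_le_rpow_of_exponent_le (by norm_num) (Nat.le_ceil _)
  · have h1 := (Nat.ceil_lt_add_one (div_nonneg hlx hl2.le)).le
    have h2 : Real.log x / Real.log 2 ≤ 2 * Real.log x := by
      rw [div_le_iff₀ hl2]
      nlinarith [Real.log_two_gt_d9]
    linarith

lemma norm_sum_e2pi_Ico_le (f : ℤ → ℝ) {u v : ℤ} {x : ℝ} (h0 : 0 ≤ x) (h : ((v - u : ℤ) : ℝ) ≤ x) :
    ‖∑ n ∈ Finset.Ico u v, e2pi (f n)‖ ≤ x := by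
  refine (norm_sum_e2pi_le _ _).trans ?_
  rw [Int.card_Ico]
  rcases le_total u v with huv | huv
  · have : ((v - u).toNat : ℤ) = v - u := Int.toNat_of_nonneg (by omega)
    have h2 : ((v - u).toNat : ℝ) = ((v - u : ℤ) : ℝ) := by exact_mod_cast this
    rw [h2]; exact h
  · rw [Int.toNat_of_nonpos (by omega)]; simpa using h0

lemma norm_sum_dyadic_right (f : ℤ → ℝ) {m b : ℤ} {K : ℕ} {E : ℝ} (hE : 0 ≤ E)
    (h : ∀ j : ℕ, ∀ u v, m + 2 ^ j * K = u → u ≤ v → v ≤ m + 2 ^ (j + 1) * K → v ≤ b →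
      ‖∑ n ∈ Finset.Ico u v, e2pi (f n)‖ ≤ E) (J : ℕ) :
    ∀ v, m ≤ v → v ≤ m + 2 ^ J * K → v ≤ b →
      ‖∑ n ∈ Finset.Ico m v, e2pi (f n)‖ ≤ K + J * E := by
  induction J with
  | zero =>
    intro v h1 h2 _
    have : (0 : ℝ) ≤ K := Nat.cast_nonneg K
    refine (norm_sum_e2pi_Ico_le f this ?_).trans (by simp)
    have : v - m ≤ (K : ℤ) := by simp at h2; omega
    exact_mod_cast this
  | succ J ih =>
    intro v h1 h2 h3
    push_cast
    rcases le_total v (m + 2 ^ J * K) with hv | hv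
    · have := ih v h1 hv h3
      linarith
    · have hm : m ≤ m + 2 ^ J * K := by
        have : (0 : ℤ) ≤ 2 ^ J * K := by positivity
        omega
      have a1 := ih _ hm le_rfl (hv.trans h3)
      have a2 := h J _ v rfl hv h2 h3
      have := norm_sum_Ico_split (fun n => e2pi (f n)) hm hv
      linarith

lemma norm_sum_dyadic_left (f : ℤ → ℝ) {m a : ℤ} {K : ℕ} {E : ℝ} (hE : 0 ≤ E)
    (h : ∀ j : ℕ, ∀ u v, m - 2 ^ j * K = v → u ≤ v → m - 2 ^ (j + 1) * K ≤ u → a ≤ u →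
      ‖∑ n ∈ Finset.Ico u v, e2pi (f n)‖ ≤ E) (J : ℕ) :
    ∀ u, u ≤ m → m - 2 ^ J * K ≤ u → a ≤ u →
      ‖∑ n ∈ Finset.Ico u m, e2pi (f n)‖ ≤ K + J * E := by
  induction J with
  | zero =>
    intro v h1 h2 _
    have : (0 : ℝ) ≤ K := Nat.cast_nonneg K
    refine (norm_sum_e2pi_Ico_le f this ?_).trans (by simp)
    have : m - v ≤ (K : ℤ) := by simp at h2; omega
    exact_mod_cast this
  | succ J ih =>
    intro u h1 h2 h3
    push_cast
    rcases le_total (m - 2 ^ J * K) u with hv | hv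
    · have := ih u h1 hv h3
      linarith
    · have hm : m - 2 ^ J * K ≤ m := by
        have : (0 : ℤ) ≤ 2 ^ J * K := by positivity
        omega
      have a1 := ih _ hm le_rfl (h3.trans hv)
      have a2 := h J u _ rfl hv h2 h3
      have := norm_sum_Ico_split (fun n => e2pi (f n)) hv hm
      linarith

set_option maxHeartbeats 1000000 in
/-- Exponential sums over a short range, in terms of a lower and upper bound `θ ^ 6`, `c * θ ^ 6`
for the increments of the second difference. -/
lemma chunk_bound {f : ℤ → ℝ} {a b : ℤ} {c θ W : ℝ} (hc : 1 ≤ c) (hθ : 0 < θ) (hθ1 : θ ≤ 1)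
    (hW0 : 0 ≤ W) (hW : ((b - a : ℤ) : ℝ) ≤ W) (hcW : 16 * c * θ ^ 4 * W ≤ 1)
    (hinc : ∀ n, a ≤ n → n + 1 < b → θ ^ 6 ≤ secondDiff f (n + 1) - secondDiff f n)
    (hinc' : ∀ n, a ≤ n → n + 1 < b → secondDiff f (n + 1) - secondDiff f n ≤ c * θ ^ 6) :
    ‖∑ n ∈ Finset.Ico a b, e2pi (f n)‖ ≤
      11000 * c * (1 + Real.log (1 + 1 / θ)) ^ 2 * (W * θ + 1 / θ ^ 2) := by
  set G := 1 + Real.log (1 + 1 / θ) with hG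
  have hθinv : 1 ≤ 1 / θ := by rw [le_div_iff₀ hθ]; linarith
  have hlog1 : 0 ≤ Real.log (1 + 1 / θ) := Real.log_nonneg (by linarith)
  have hlogθ : Real.log (1 / θ) ≤ Real.log (1 + 1 / θ) :=
    Real.log_le_log (by positivity) (by linarith)
  have hG1 : 1 ≤ G := by linarith
  rcases lt_or_ge b a with hab | hab
  · rw [Finset.Ico_eq_empty (by omega), Finset.sum_empty, norm_zero]
    positivity
  set P := W * θ + 1 / θ ^ 2 with hP
  have hP0 : 0 < P := by positivity
  set K : ℕ := ⌊1 / θ ^ 2⌋₊ with hKdef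
  have hx1 : 1 ≤ 1 / θ ^ 2 := by
    rw [le_div_iff₀ (by positivity), one_mul]
    exact pow_le_one₀ hθ.le hθ1
  have hKle : (K : ℝ) ≤ 1 / θ ^ 2 := Nat.floor_le (by positivity)
  have hK : 0 < K := Nat.floor_pos.mpr hx1
  have hK' : (1 : ℝ) ≤ K := by exact_mod_cast hK
  have hK0 : (0 : ℝ) < K := by linarith
  have hKge : 1 / θ ^ 2 ≤ 2 * K := by
    have := (Nat.lt_floor_add_one (1 / θ ^ 2)).le
    rw [← hKdef] at this
    linarith
  have hKθ : K * θ ^ 2 ≤ 1 := by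
    rwa [le_div_iff₀ (by positivity)] at hKle
  have hKinv : 1 / (K : ℝ) ≤ 2 * θ ^ 2 := by
    rw [div_le_iff₀ hK0]
    rw [div_le_iff₀ (by positivity)] at hKge
    linarith
  have hK3 : (K : ℝ) ^ 3 * θ ^ 6 ≤ 1 := by
    calc (K : ℝ) ^ 3 * θ ^ 6 = (K * θ ^ 2) ^ 3 := by ring
      _ ≤ 1 := pow_le_one₀ (by positivity) hKθ
  have hL : 1 + Real.log (8 * K) ≤ 4 * G := by
    have h1 : Real.log (8 * K) ≤ Real.log (8 * (1 / θ ^ 2)) :=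
      Real.log_le_log (by positivity) (by gcongr)
    have h2 : Real.log (8 * (1 / θ ^ 2)) = 3 * Real.log 2 + 2 * Real.log (1 / θ) := by
      rw [Real.log_mul (by norm_num) (by positivity), show (8 : ℝ) = 2 ^ 3 by norm_num,
        Real.log_pow, show 1 / θ ^ 2 = (1 / θ) ^ 2 by rw [one_div_pow], Real.log_pow]
      norm_num
    have := Real.log_two_lt_d9
    linarith
  have hL0 : 0 < 1 + Real.log (8 * K) := by
    have : 0 ≤ Real.log (8 * K) := Real.log_nonneg (by linarith)
    linarith
  obtain ⟨J, hJ1, hJ2⟩ := exists_two_pow_ge (x := 1 / θ ^ 4) (by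
    rw [le_div_iff₀ (by positivity), one_mul]
    exact pow_le_one₀ hθ.le hθ1)
  have hJG : (J : ℝ) ≤ 8 * G := by
    rw [show 1 / θ ^ 4 = (1 / θ) ^ 4 by rw [one_div_pow], Real.log_pow] at hJ2
    push_cast at hJ2
    linarith
  have hWJ : W ≤ 2 ^ J * K := by
    have h1 : W ≤ 1 / θ ^ 4 := by
      rw [le_div_iff₀ (by positivity)]
      have : 0 ≤ θ ^ 4 * W := by positivity
      nlinarith
    have h2 : (2 : ℝ) ^ J * 1 ≤ 2 ^ J * K := by gcongr
    linarith
  have hWJ' : b - a ≤ 2 ^ J * (K : ℤ) := by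
    have := hW.trans hWJ
    exact_mod_cast this
  obtain ⟨ρ, hρ1, hρ2⟩ := Real.exists_rat_abs_sub_le_and_den_le (secondDiff f a)
    (n := 8 * K) (by omega)
  have hq0 : (0 : ℝ) < ρ.den := by exact_mod_cast ρ.den_pos
  have hρ3 : |secondDiff f a - ρ| ≤ 1 / (8 * K * ρ.den) := by
    refine hρ1.trans ?_
    push_cast
    gcongr
    linarith
  have hρ0 : 0 ≤ 1 / (8 * K * ρ.den : ℝ) := by positivity
  have hs := abs_le.mp hρ3
  set E := 640 * c * G * P with hE
  have hE0 : 0 ≤ E := by positivity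
  have hshell : ∀ Y : ℝ, ∀ u v : ℤ, (K : ℝ) ≤ Y → Y ≤ W → ((v - u : ℤ) : ℝ) ≤ Y →
      a ≤ u → v ≤ b → ((∀ n, u ≤ n → n < v → θ ^ 6 * Y ≤ secondDiff f n - ρ ∧
        secondDiff f n - ρ ≤ 1 / (8 * K * ρ.den) + (2 * c) * θ ^ 6 * Y) ∨
      (∀ n, u ≤ n → n < v → θ ^ 6 * Y ≤ ρ - secondDiff f n ∧
        ρ - secondDiff f n ≤ 1 / (8 * K * ρ.den) + (2 * c) * θ ^ 6 * Y)) →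
      ‖∑ n ∈ Finset.Ico u v, e2pi (f n)‖ ≤ E := by
    intro Y u v hKY hYW hvY hau hvb hside
    have hY0 : 0 < Y := by linarith
    have hcY : 2 * c * θ ^ 6 * Y * K ≤ 1 / 8 := by
      calc 2 * c * θ ^ 6 * Y * K = (2 * c * θ ^ 4 * Y) * (K * θ ^ 2) := by ring
        _ ≤ (2 * c * θ ^ 4 * W) * 1 := by gcongr
        _ ≤ 1 / 8 := by linarith
    have h1 := shell_bound (c := 2 * c) (by linarith) (by positivity) hK hK3 hρ2 hKY hvY hcY
      (fun n hn hn' => hinc n (by omega) (by omega)) hside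
    refine abs_le_of_sq_le_sq' ?_ hE0 |>.2
    refine h1.trans ?_
    have h2 : Y ^ 2 / K + 1 / (K * θ ^ 6) ≤ 2 * P ^ 2 := by
      calc Y ^ 2 / K + 1 / (K * θ ^ 6) = Y ^ 2 * (1 / K) + 1 / K * (1 / θ ^ 6) := by
            field_simp
        _ ≤ W ^ 2 * (2 * θ ^ 2) + 2 * θ ^ 2 * (1 / θ ^ 6) := by gcongr
        _ = 2 * ((W * θ) ^ 2 + (1 / θ ^ 2) ^ 2) := by field_simp
        _ ≤ 2 * P ^ 2 := by
          have : 0 ≤ W * θ * (1 / θ ^ 2) := by positivity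
          rw [hP]
          nlinarith
    calc 6000 * (2 * c) * (1 + Real.log (8 * K)) * (Y ^ 2 / K + 1 / (K * θ ^ 6))
        ≤ 6000 * (2 * c) * (4 * G) * (2 * P ^ 2) := by gcongr
      _ = 96000 * (c * 1) * (G * 1) * P ^ 2 := by ring
      _ ≤ 409600 * (c * c) * (G * G) * P ^ 2 := by gcongr; norm_num
      _ = E ^ 2 := by rw [hE]; ring
  have hmono : ∀ n, a ≤ n → n + 1 < b → secondDiff f n ≤ secondDiff f (n + 1) := by
    intro n h1 h2
    have := hinc n h1 h2
    have : 0 < θ ^ 6 := by positivity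
    linarith
  obtain ⟨m, hm1, hm2, hm3, hm4⟩ := exists_monotone_cut (fun n => (ρ : ℝ) ≤ secondDiff f n) hab
    (fun n h1 h2 h3 => h3.trans (hmono n h1 h2))
  have hlow : ∀ p r, a ≤ p → p ≤ r → r < b → θ ^ 6 * (r - p) ≤ secondDiff f r - secondDiff f p :=
    fun p r h1 h2 h3 => mul_le_sub_of_le_increment hinc h1 h2 h3
  have hupp : ∀ p r, a ≤ p → p ≤ r → r < b →
      secondDiff f r - secondDiff f p ≤ c * θ ^ 6 * (r - p) := by
    intro p r h1 h2 h3
    have := mul_le_sub_of_le_increment (s := fun n => - secondDiff f n) (l := -(c * θ ^ 6))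
      (fun n h4 h5 => by have := hinc' n h4 h5; linarith) h1 h2 h3
    linarith
  have hright : ‖∑ n ∈ Finset.Ico m b, e2pi (f n)‖ ≤ K + J * E := by
    refine norm_sum_dyadic_right f hE0 ?_ J b hm2 (by omega) le_rfl
    intro j u v hu huv hv hvb
    rcases eq_or_lt_of_le huv with rfl | huv'
    · simpa using hE0
    have hjK : (0 : ℤ) ≤ 2 ^ j * K := by positivity
    have hYW : ((2 ^ j * K : ℤ) : ℝ) ≤ W := by
      refine le_trans ?_ hW
      exact_mod_cast (by omega : 2 ^ j * (K : ℤ) ≤ b - a)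
    push_cast at hYW
    have hvu : ((v - u : ℤ) : ℝ) ≤ 2 ^ j * K := by
      have : v - u ≤ 2 ^ j * (K : ℤ) := by rw [pow_succ] at hv; linarith
      exact_mod_cast this
    have hKY : (K : ℝ) ≤ 2 ^ j * K :=
      le_mul_of_one_le_left hK0.le (one_le_pow₀ (by norm_num))
    refine hshell (2 ^ j * K) u v hKY hYW hvu (by omega) hvb (Or.inl fun n h1 h2 => ?_)
    have hn1 : (2 : ℝ) ^ j * K ≤ n - m := by
      have : 2 ^ j * (K : ℤ) ≤ n - m := by omega
      exact_mod_cast this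
    have hn2 : (n : ℝ) - m + 1 ≤ 2 * (2 ^ j * K) := by
      have : n - m + 1 ≤ 2 * (2 ^ j * (K : ℤ)) := by rw [pow_succ] at hv; linarith
      exact_mod_cast this
    have hmb : m < b := by omega
    constructor
    · have h3 := hlow m n hm1 (by omega) (by omega)
      have h4 := hm4 m le_rfl hmb
      have h5 : θ ^ 6 * (2 ^ j * K) ≤ θ ^ 6 * (n - m) := by gcongr
      linarith
    · have h6 : c * θ ^ 6 * (n - m + 1) ≤ c * θ ^ 6 * (2 * (2 ^ j * K)) := by gcongr
      have h7 : 0 ≤ c * θ ^ 6 := by positivity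
      rcases eq_or_lt_of_le hm1 with h | h
      · have h3 := hupp a n le_rfl (by omega) (by omega)
        rw [h] at h3 hs
        linarith [hs.2]
      · have h3 := hupp (m - 1) n (by omega) (by omega) (by omega)
        have h4 := not_le.mp (hm3 (m - 1) (by omega) (by omega))
        push_cast at h3
        linarith
  have hleft : ‖∑ n ∈ Finset.Ico a m, e2pi (f n)‖ ≤ K + J * E := by
    refine norm_sum_dyadic_left f hE0 ?_ J a hm1 (by omega) le_rfl
    intro j u v hv huv hu hau
    rcases eq_or_lt_of_le huv with rfl | huv'
    · simpa using hE0
    have hjK : (0 : ℤ) ≤ 2 ^ j * K := by positivity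
    have hYW : ((2 ^ j * K : ℤ) : ℝ) ≤ W := by
      refine le_trans ?_ hW
      exact_mod_cast (by omega : 2 ^ j * (K : ℤ) ≤ b - a)
    push_cast at hYW
    have hvu : ((v - u : ℤ) : ℝ) ≤ 2 ^ j * K := by
      have : v - u ≤ 2 ^ j * (K : ℤ) := by rw [pow_succ] at hu; linarith
      exact_mod_cast this
    have hKY : (K : ℝ) ≤ 2 ^ j * K :=
      le_mul_of_one_le_left hK0.le (one_le_pow₀ (by norm_num))
    refine hshell (2 ^ j * K) u v hKY hYW hvu hau (by omega) (Or.inr fun n h1 h2 => ?_)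
    have hn1 : (2 : ℝ) ^ j * K ≤ m - 1 - n := by
      have : 2 ^ j * (K : ℤ) ≤ m - 1 - n := by omega
      exact_mod_cast this
    have h5 : 0 ≤ 2 * c * θ ^ 6 * (2 ^ j * K) := by positivity
    constructor
    · have h3 := hlow n (m - 1) (by omega) (by omega) (by omega)
      have h4 := not_le.mp (hm3 (m - 1) (by omega) (by omega))
      have h5 : θ ^ 6 * (2 ^ j * K) ≤ θ ^ 6 * (m - 1 - n) := by gcongr
      push_cast at h3
      linarith
    · have h3 := hlow a n le_rfl (by omega) (by omega)
      have h6 : 0 ≤ θ ^ 6 * ((n : ℝ) - a) := by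
        have : (a : ℝ) ≤ n := by exact_mod_cast hau.trans h1
        have : 0 ≤ (n : ℝ) - a := by linarith
        positivity
      linarith [hs.1]
  have hsplit := norm_sum_Ico_split (fun n => e2pi (f n)) hm1 hm2
  have hKP : (K : ℝ) ≤ P := by
    have : 0 ≤ W * θ := by positivity
    linarith
  have hJE : J * E ≤ 8 * G * E := by gcongr
  have hPP : P ≤ c * G ^ 2 * P := by
    have : 1 ≤ c * G ^ 2 := one_le_mul_of_one_le_of_one_le hc (one_le_pow₀ hG1)
    exact le_mul_of_one_le_left hP0.le this
  have : 8 * G * E = 5120 * (c * G ^ 2 * P) := by rw [hE]; ring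
  have : 0 ≤ c * G ^ 2 * P := by positivity
  have : 11000 * c * G ^ 2 * P = 11000 * (c * G ^ 2 * P) := by ring
  linarith

end Chunk

section ThirdDifference

/-- **Third derivative test** with the exponent `1 / 6` replaced by the saving of
Gritsenko and Sargos: no loss of the form `D ^ (1 / 2)` occurs. -/
lemma third_difference_test {f : ℤ → ℝ} {a b : ℤ} {c θ D : ℝ} (hc : 1 ≤ c) (hθ : 0 < θ)
    (hD0 : 0 ≤ D) (hD : ((b - a : ℤ) : ℝ) ≤ D)
    (hinc : ∀ n, a ≤ n → n + 1 < b → θ ^ 6 ≤ secondDiff f (n + 1) - secondDiff f n)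
    (hinc' : ∀ n, a ≤ n → n + 1 < b → secondDiff f (n + 1) - secondDiff f n ≤ c * θ ^ 6) :
    ‖∑ n ∈ Finset.Ico a b, e2pi (f n)‖ ≤
      600000 * c ^ 2 * (1 + Real.log (1 + 1 / θ)) ^ 2 * (D * θ + 1 / θ ^ 2) := by
  set G := 1 + Real.log (1 + 1 / θ) with hG
  have hθi : 0 < 1 / θ := by positivity
  have hG1 : 1 ≤ G := by
    have := Real.log_nonneg (show 1 ≤ 1 + 1 / θ by linarith)
    linarith
  have hG2 : 1 ≤ G ^ 2 := one_le_pow₀ hG1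
  have hc2 : c ≤ c ^ 2 := by nlinarith
  set P := D * θ + 1 / θ ^ 2 with hP
  have hP0 : 0 < P := by positivity
  rcases lt_or_ge 1 (16 * c * θ ^ 4) with hbig | hsmall
  · have h1 : 1 ≤ 16 * c * θ := by
      rcases le_total θ 1 with h | h
      · have : θ ^ 4 ≤ θ := by
          calc θ ^ 4 = θ * θ ^ 3 := by ring
            _ ≤ θ * 1 := by gcongr; exact pow_le_one₀ hθ.le h
            _ = θ := mul_one θ
        have : 16 * c * θ ^ 4 ≤ 16 * c * θ := by gcongr
        linarith
      · nlinarith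
    calc _ ≤ D := norm_sum_e2pi_Ico_le f hD0 hD
      _ ≤ D * (16 * c * θ) := le_mul_of_one_le_right hD0 h1
      _ = 16 * c * 1 * (D * θ) := by ring
      _ ≤ 600000 * c ^ 2 * G ^ 2 * P := by
        have : D * θ ≤ P := by
          have : 0 < 1 / θ ^ 2 := by positivity
          linarith
        gcongr
        norm_num
  have hθ4 : 0 < 16 * c * θ ^ 4 := by positivity
  have hθ1 : θ ≤ 1 := by
    by_contra! h
    have : 1 < θ ^ 4 := one_lt_pow₀ h (by norm_num)
    nlinarith
  set V := 1 / (16 * c * θ ^ 4) with hV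
  have hV1 : 1 ≤ V := by rwa [hV, le_div_iff₀ hθ4, one_mul]
  have hV0 : 0 < V := by linarith
  have hVθ : 16 * c * θ ^ 4 * V = 1 := mul_one_div_cancel hθ4.ne'
  rcases le_or_gt D V with hDV | hDV
  · refine (chunk_bound hc hθ hθ1 hD0 hD ?_ hinc hinc').trans ?_
    · rw [← hVθ]; gcongr
    · gcongr
      norm_num
  set E := 11000 * c * G ^ 2 * (V * θ + 1 / θ ^ 2) with hE
  have hE0 : 0 ≤ E := by positivity
  set w : ℕ := ⌊V⌋₊ with hw
  have hw1 : 1 ≤ w := Nat.one_le_floor_iff _ |>.mpr hV1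
  have hw1' : (1 : ℝ) ≤ w := by exact_mod_cast hw1
  have hwV : (w : ℝ) ≤ V := Nat.floor_le hV0.le
  have hwV' : V ≤ 2 * w := by
    have := (Nat.lt_floor_add_one V).le
    rw [← hw] at this
    linarith
  have hind : ∀ t : ℕ, ∀ v, a ≤ v → v ≤ a + t * w → v ≤ b →
      ‖∑ n ∈ Finset.Ico a v, e2pi (f n)‖ ≤ t * E := by
    intro t
    induction t with
    | zero =>
      intro v h1 h2 _
      have : v = a := by simp at h2; omega
      simp [this]
    | succ t ih =>
      intro v h1 h2 h3
      push_cast at h2 ⊢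
      rcases le_total v (a + t * w) with hv | hv
      · have := ih v h1 hv h3
        linarith
      · have hm : a ≤ a + t * w := by
          have : (0 : ℤ) ≤ t * w := by positivity
          omega
        have a1 := ih _ hm le_rfl (hv.trans h3)
        have a2 : ‖∑ n ∈ Finset.Ico (a + t * w) v, e2pi (f n)‖ ≤ E := by
          refine chunk_bound hc hθ hθ1 hV0.le ?_ hVθ.le
            (fun n h4 h5 => hinc n (by omega) (by omega))
            (fun n h4 h5 => hinc' n (by omega) (by omega))
          refine le_trans ?_ hwV
          have : v - (a + t * w) ≤ w := by linarith
          exact_mod_cast this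
        have := norm_sum_Ico_split (fun n => e2pi (f n)) hm hv
        linarith
  rcases lt_or_ge b a with hab | hab
  · rw [Finset.Ico_eq_empty (by omega), Finset.sum_empty, norm_zero]
    positivity
  have hw0 : (0 : ℝ) < w := by linarith
  have ht := hind ⌈D / w⌉₊ b hab (by
    have h1 : D ≤ ⌈D / w⌉₊ * w := by
      rw [← div_le_iff₀ hw0]; exact Nat.le_ceil _
    have h2 := hD.trans h1
    have h3 : b - a ≤ ⌈D / w⌉₊ * (w : ℤ) := by exact_mod_cast h2
    linarith) le_rfl
  refine ht.trans ?_
  have hcount : (⌈D / w⌉₊ : ℝ) ≤ 3 * (D / V) := by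
    have h1 := (Nat.ceil_lt_add_one (div_nonneg hD0 hw0.le)).le
    have h2 : D / w ≤ 2 * (D / V) := by
      rw [mul_div_assoc', div_le_div_iff₀ hw0 hV0]
      nlinarith
    have h3 : 1 ≤ D / V := by rw [le_div_iff₀ hV0]; linarith
    linarith
  have hDVeq : D / V = 16 * c * θ ^ 4 * D := by
    rw [hV, div_div_eq_mul_div, div_one]; ring
  calc ⌈D / w⌉₊ * E ≤ 3 * (D / V) * E := by gcongr
    _ = 33000 * c * G ^ 2 * ((D / V) * V * θ + (D / V) * (1 / θ ^ 2)) := by rw [hE]; ring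
    _ = 33000 * c * G ^ 2 * (D * θ + 16 * c * D * θ * θ) := by
      rw [div_mul_cancel₀ _ hV0.ne', hDVeq]
      field_simp
    _ ≤ 33000 * c * G ^ 2 * (c * D * θ + 16 * c * D * θ * 1) := by
      have : D * θ ≤ c * D * θ := by
        rw [mul_assoc]; exact le_mul_of_one_le_left (by positivity) hc
      gcongr
    _ = 561000 * c ^ 2 * G ^ 2 * (D * θ) := by ring
    _ ≤ 600000 * c ^ 2 * G ^ 2 * P := by
      have : D * θ ≤ P := by
        have : 0 < 1 / θ ^ 2 := by positivity
        linarith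
      gcongr
      norm_num

end ThirdDifference

section PowerPhase

lemma exists_third_difference_eq {h h₁ h₂ h₃ : ℝ → ℝ} {n : ℝ}
    (d₁ : ∀ x, n ≤ x → HasDerivAt h (h₁ x) x) (d₂ : ∀ x, n ≤ x → HasDerivAt h₁ (h₂ x) x)
    (d₃ : ∀ x, n ≤ x → HasDerivAt h₂ (h₃ x) x) :
    ∃ ξ, n < ξ ∧ ξ < n + 3 ∧ h (n + 3) - 3 * h (n + 2) + 3 * h (n + 1) - h n = h₃ ξ := by
  have mvt : ∀ (g g' : ℝ → ℝ) (x : ℝ), n ≤ x → (∀ y, n ≤ y → HasDerivAt g (g' y) y) →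
      ∃ y, x < y ∧ y < x + 1 ∧ g (x + 1) - g x = g' y := by
    intro g g' x hx hg
    obtain ⟨y, hy, hy'⟩ := exists_hasDerivAt_eq_slope g g' (a := x) (b := x + 1) (by linarith)
      (fun z hz => (hg z (hx.trans hz.1)).continuousAt.continuousWithinAt)
      (fun z hz => hg z (hx.trans hz.1.le))
    refine ⟨y, hy.1, hy.2, ?_⟩
    rw [hy']; simp
  have shift : ∀ (g g' : ℝ → ℝ), (∀ y, n ≤ y → HasDerivAt g (g' y) y) → ∀ y, n ≤ y →
      HasDerivAt (fun x => g (x + 1) - g x) (g' (y + 1) - g' y) y := by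
    intro g g' hg y hy
    exact ((hg (y + 1) (by linarith)).comp_add_const y 1).sub (hg y hy)
  obtain ⟨x, hx1, hx2, hx3⟩ := mvt _ _ n le_rfl (shift _ _ (shift _ _ d₁))
  obtain ⟨y, hy1, hy2, hy3⟩ := mvt _ _ x hx1.le (shift _ _ d₂)
  obtain ⟨z, hz1, hz2, hz3⟩ := mvt _ _ y (hx1.trans hy1).le d₃
  refine ⟨z, by linarith, by linarith, ?_⟩
  rw [← hz3, ← hy3, ← hx3, show n + 1 + 1 = n + 2 by ring, show n + 2 + 1 = n + 3 by ring]
  ring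

lemma third_difference_rpow_bounds {γ D x : ℝ} (hγ0 : 0 < γ) (hγ1 : γ < 1) (hD : 1 ≤ D)
    (hx : D ≤ x) (hx2 : x ≤ 2 * D) :
    γ * (1 - γ) * (2 - γ) / 125 * D ^ (γ - 3) ≤
        (x + 3) ^ γ - 3 * (x + 2) ^ γ + 3 * (x + 1) ^ γ - x ^ γ ∧
      (x + 3) ^ γ - 3 * (x + 2) ^ γ + 3 * (x + 1) ^ γ - x ^ γ ≤
        γ * (1 - γ) * (2 - γ) * D ^ (γ - 3) := by
  have hx0 : 0 < x := by linarith
  obtain ⟨ξ, h1, h2, h3⟩ := exists_third_difference_eq (n := x) (h := fun y => y ^ γ)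
    (h₁ := fun y => γ * y ^ (γ - 1)) (h₂ := fun y => γ * ((γ - 1) * y ^ (γ - 2)))
    (h₃ := fun y => γ * ((γ - 1) * ((γ - 2) * y ^ (γ - 3))))
    (fun y hy => Real.hasDerivAt_rpow_const (Or.inl (by linarith)))
    (fun y hy => by
      have := (Real.hasDerivAt_rpow_const (p := γ - 1) (Or.inl (by linarith : y ≠ 0))).const_mul γ
      rwa [show γ - 1 - 1 = γ - 2 by ring] at this)
    (fun y hy => by
      have := ((Real.hasDerivAt_rpow_const (p := γ - 2)
        (Or.inl (by linarith : y ≠ 0))).const_mul (γ - 1)).const_mul γ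
      rwa [show γ - 2 - 1 = γ - 3 by ring] at this)
  rw [h3]
  have hξ : 0 < ξ := by linarith
  have u1 : ξ ^ (γ - 3) ≤ D ^ (γ - 3) :=
    Real.rpow_le_rpow_of_nonpos (by linarith) (by linarith) (by linarith)
  have u2 : 1 / 125 * D ^ (γ - 3) ≤ ξ ^ (γ - 3) := by
    have a1 : (5 * D) ^ (γ - 3) ≤ ξ ^ (γ - 3) :=
      Real.rpow_le_rpow_of_nonpos hξ (by linarith) (by linarith)
    have a2 : (1 : ℝ) / 125 ≤ 5 ^ (γ - 3) := by
      calc (1 : ℝ) / 125 = 5 ^ (-3 : ℝ) := by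
            rw [Real.rpow_neg (by norm_num)]; norm_num
        _ ≤ 5 ^ (γ - 3) := Real.rpow_le_rpow_of_exponent_le (by norm_num) (by linarith)
    rw [Real.mul_rpow (by norm_num) (by linarith)] at a1
    refine le_trans ?_ a1
    gcongr
  have hc : 0 < γ * (1 - γ) * (2 - γ) := by
    have : 0 < 1 - γ := by linarith
    have : 0 < 2 - γ := by linarith
    positivity
  have e : γ * ((γ - 1) * ((γ - 2) * ξ ^ (γ - 3))) = γ * (1 - γ) * (2 - γ) * ξ ^ (γ - 3) := by ring
  rw [e]
  refine ⟨?_, by gcongr⟩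
  calc γ * (1 - γ) * (2 - γ) / 125 * D ^ (γ - 3)
      = γ * (1 - γ) * (2 - γ) * (1 / 125 * D ^ (γ - 3)) := by ring
    _ ≤ _ := by gcongr

lemma rpow_sub_rpow_bounds {γ L y z : ℝ} (hγ0 : 0 < γ) (hγ1 : γ < 1) (hL : 0 < L)
    (hz : L / 2 < z) (hzy : z < y) (hy : y ≤ 2 * L) :
    γ / 2 * (y - z) * L ^ (γ - 1) ≤ y ^ γ - z ^ γ ∧
      y ^ γ - z ^ γ ≤ 2 * γ * (y - z) * L ^ (γ - 1) := by
  have hz0 : 0 < z := by linarith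
  obtain ⟨ξ, hξ, h⟩ := exists_hasDerivAt_eq_slope (fun x : ℝ => x ^ γ) (fun x => γ * x ^ (γ - 1))
    hzy
    (fun x hx => (Real.hasDerivAt_rpow_const
      (Or.inl (by linarith [hx.1]))).continuousAt.continuousWithinAt)
    (fun x hx => Real.hasDerivAt_rpow_const (Or.inl (by linarith [hx.1])))
  have hyz : 0 < y - z := by linarith
  rw [eq_div_iff hyz.ne'] at h
  rw [← h]
  have hξ0 : 0 < ξ := by linarith [hξ.1]
  have a1 : 1 / 2 * L ^ (γ - 1) ≤ ξ ^ (γ - 1) := by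
    have a1 : (2 * L) ^ (γ - 1) ≤ ξ ^ (γ - 1) :=
      Real.rpow_le_rpow_of_nonpos hξ0 (by linarith [hξ.2]) (by linarith)
    have a2 : (1 : ℝ) / 2 ≤ 2 ^ (γ - 1) := by
      calc (1 : ℝ) / 2 = 2 ^ (-1 : ℝ) := by
            rw [Real.rpow_neg (by norm_num)]; norm_num
        _ ≤ 2 ^ (γ - 1) := Real.rpow_le_rpow_of_exponent_le (by norm_num) (by linarith)
    rw [Real.mul_rpow (by norm_num) hL.le] at a1
    refine le_trans ?_ a1
    gcongr
  have a2 : ξ ^ (γ - 1) ≤ 2 * L ^ (γ - 1) := by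
    have a1 : ξ ^ (γ - 1) ≤ (1 / 2 * L) ^ (γ - 1) :=
      Real.rpow_le_rpow_of_nonpos (by linarith) (by linarith [hξ.1]) (by linarith)
    have a2 : (1 / 2 : ℝ) ^ (γ - 1) ≤ 2 := by
      calc (1 / 2 : ℝ) ^ (γ - 1) ≤ (1 / 2) ^ (-1 : ℝ) :=
            Real.rpow_le_rpow_of_exponent_ge (by norm_num) (by norm_num) (by linarith)
        _ = 2 := by rw [Real.rpow_neg (by norm_num)]; norm_num
    rw [Real.mul_rpow (by norm_num) hL.le] at a1
    refine a1.trans ?_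
    gcongr
  constructor
  · calc γ / 2 * (y - z) * L ^ (γ - 1) = γ * (1 / 2 * L ^ (γ - 1)) * (y - z) := by ring
      _ ≤ _ := by gcongr
  · calc γ * ξ ^ (γ - 1) * (y - z) ≤ γ * (2 * L ^ (γ - 1)) * (y - z) := by gcongr
      _ = _ := by ring

lemma exists_one_add_log_le (A : ℝ) {δ : ℝ} (hδ : 0 < δ) :
    ∃ C > 0, ∀ x N : ℝ, 1 ≤ N → 1 ≤ x → x ≤ A * N → 1 + Real.log x ≤ C * N ^ δ := by
  refine ⟨1 + |Real.log A| + 1 / δ, by positivity, fun x N hN hx hxA => ?_⟩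
  have hN0 : 0 < N := by linarith
  have hA : 0 < A := by
    by_contra! h
    nlinarith
  have h1 : Real.log x ≤ Real.log A + Real.log N := by
    rw [← Real.log_mul hA.ne' hN0.ne']
    exact Real.log_le_log (by linarith) hxA
  have h2 : Real.log N ≤ N ^ δ / δ := Real.log_le_rpow_div hN0.le hδ
  have h3 : 1 ≤ N ^ δ := Real.one_le_rpow hN hδ.le
  have h4 := le_abs_self (Real.log A)
  have h5 := abs_nonneg (Real.log A)
  have e : (1 + |Real.log A| + 1 / δ) * N ^ δ = (1 + |Real.log A|) * N ^ δ + N ^ δ / δ := by ring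
  rw [e]
  nlinarith

set_option maxHeartbeats 1000000 in
/-- The phase difference attached to two values `y`, `z` of the short variable. -/
lemma power_phase_sum_bound (γ δ : ℝ) (hγ0 : 0 < γ) (hγ1 : γ < 1) (hδ : 0 < δ) :
    ∃ C > 0, ∀ (β M N L D y z μ Q : ℝ) (a b : ℤ), 0 < M → 1 ≤ N → 0 < L → 1 ≤ D →
      L / 2 < z → z + 1 ≤ y → y ≤ 2 * L → D ≤ a → b ≤ 2 * D →
      μ = M * L ^ (γ - 1) * D ^ (γ - 3) → 1 / μ ≤ 4 * N ^ 3 → y - z ≤ Q →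
      ‖∑ x ∈ Finset.Ico a b, e2pi ((β * (x : ℝ) ^ 2 * y ^ 2 - M * (x : ℝ) ^ γ * y ^ γ) -
        (β * (x : ℝ) ^ 2 * z ^ 2 - M * (x : ℝ) ^ γ * z ^ γ))‖ ≤
        C * N ^ δ * (D * (Q * μ) ^ ((1 : ℝ) / 6) + 1 / μ ^ ((1 : ℝ) / 3)) := by
  set κ : ℝ := γ / 2 * (γ * (1 - γ) * (2 - γ) / 125) with hκ
  have hκ0 : 0 < κ := by
    have : 0 < 1 - γ := by linarith
    have : 0 < 2 - γ := by linarith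
    positivity
  set A : ℝ := 1 + 4 * (1 / κ) ^ ((1 : ℝ) / 6) with hA
  obtain ⟨C₁, hC₁, hlog⟩ := exists_one_add_log_le A (show 0 < δ / 2 by linarith)
  set C₂ : ℝ := κ ^ ((1 : ℝ) / 6) + 1 / κ ^ ((1 : ℝ) / 3) with hC₂
  have hC₂0 : 0 < C₂ := by positivity
  refine ⟨600000 * 500 ^ 2 * C₁ ^ 2 * C₂, by positivity, ?_⟩
  intro β M N L D y z μ Q a b hM hN hL hD hz hzy hy ha hb hμ hμN hQ
  have hD0 : 0 < D := by linarith
  have hμ0 : 0 < μ := by rw [hμ]; positivity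
  have hN0 : 0 < N := by linarith
  set q := y - z with hq
  have hq1 : 1 ≤ q := by linarith
  set θ : ℝ := (κ * (q * μ)) ^ ((1 : ℝ) / 6) with hθ
  have hκqμ : 0 < κ * (q * μ) := by positivity
  have hθ0 : 0 < θ := by positivity
  have hθ6 : θ ^ 6 = κ * (q * μ) := by
    rw [hθ, ← Real.rpow_natCast, ← Real.rpow_mul hκqμ.le]; norm_num
  set f : ℤ → ℝ := fun x => -((β * (x : ℝ) ^ 2 * y ^ 2 - M * (x : ℝ) ^ γ * y ^ γ) -
        (β * (x : ℝ) ^ 2 * z ^ 2 - M * (x : ℝ) ^ γ * z ^ γ)) with hf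
  obtain ⟨B1, B2⟩ := rpow_sub_rpow_bounds hγ0 hγ1 hL hz (by linarith : z < y) hy
  have hdiff : ∀ n : ℤ, secondDiff f (n + 1) - secondDiff f n =
      M * (y ^ γ - z ^ γ) * (((n : ℝ) + 3) ^ γ - 3 * ((n : ℝ) + 2) ^ γ + 3 * ((n : ℝ) + 1) ^ γ -
        (n : ℝ) ^ γ) := by
    intro n
    simp only [secondDiff, hf]
    push_cast
    rw [show (n : ℝ) + 1 + 2 = n + 3 by ring, show (n : ℝ) + 1 + 1 = n + 2 by ring]
    ring
  have hBpos : 0 ≤ y ^ γ - z ^ γ := le_trans (by positivity) B1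
  have hγ3 : 0 < γ * (1 - γ) * (2 - γ) := by
    have : 0 < 1 - γ := by linarith
    have : 0 < 2 - γ := by linarith
    positivity
  have hbounds : ∀ n : ℤ, a ≤ n → n + 1 < b →
      θ ^ 6 ≤ secondDiff f (n + 1) - secondDiff f n ∧
      secondDiff f (n + 1) - secondDiff f n ≤ 500 * θ ^ 6 := by
    intro n h1 h2
    have h1' : (a : ℝ) ≤ n := by exact_mod_cast h1
    have h2' : (n : ℝ) + 1 < b := by exact_mod_cast h2
    obtain ⟨T1, T2⟩ := third_difference_rpow_bounds hγ0 hγ1 hD (ha.trans h1') (by linarith)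
    rw [hdiff, hθ6, hμ]
    have T0 := le_trans (by positivity : 0 ≤ γ * (1 - γ) * (2 - γ) / 125 * D ^ (γ - 3)) T1
    constructor
    · calc κ * (q * (M * L ^ (γ - 1) * D ^ (γ - 3)))
          = M * (γ / 2 * q * L ^ (γ - 1)) * (γ * (1 - γ) * (2 - γ) / 125 * D ^ (γ - 3)) := by
            rw [hκ]; ring
        _ ≤ _ := by gcongr
    · calc _ ≤ M * (2 * γ * q * L ^ (γ - 1)) * (γ * (1 - γ) * (2 - γ) * D ^ (γ - 3)) := by gcongr
        _ = _ := by rw [hκ]; ring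
  have hab : ((b - a : ℤ) : ℝ) ≤ D := by push_cast; linarith
  have main := third_difference_test (f := f) (c := 500) (by norm_num) hθ0 hD0.le hab
    (fun n h1 h2 => (hbounds n h1 h2).1) (fun n h1 h2 => (hbounds n h1 h2).2)
  rw [hf, norm_sum_e2pi_neg] at main
  refine main.trans ?_
  have hθinv : 1 / θ ≤ 4 * (1 / κ) ^ ((1 : ℝ) / 6) * N := by
    have e1 : 1 / θ = (1 / (κ * (q * μ))) ^ ((1 : ℝ) / 6) := by
      rw [hθ, Real.div_rpow zero_le_one hκqμ.le, Real.one_rpow]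
    have e2 : 1 / (κ * (q * μ)) ≤ 1 / κ * (4 ^ 6 * N ^ 6) := by
      calc 1 / (κ * (q * μ)) = 1 / κ * (1 / (q * μ)) := by field_simp
        _ ≤ 1 / κ * (1 / (1 * μ)) := by gcongr
        _ ≤ 1 / κ * (4 ^ 6 * N ^ 6) := by
          rw [one_mul]
          gcongr
          refine hμN.trans ?_
          have : N ^ 3 ≤ N ^ 6 := pow_le_pow_right₀ hN (by norm_num)
          have : 0 < N ^ 3 := by positivity
          linarith
    rw [e1]
    calc (1 / (κ * (q * μ))) ^ ((1 : ℝ) / 6) ≤ (1 / κ * (4 ^ 6 * N ^ 6)) ^ ((1 : ℝ) / 6) := by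
          gcongr
      _ = (1 / κ) ^ ((1 : ℝ) / 6) * (4 * N) := by
          rw [Real.mul_rpow (by positivity) (by positivity), ← mul_pow, ← Real.rpow_natCast,
            ← Real.rpow_mul (by positivity)]
          norm_num
      _ = _ := by ring
  have hG : 1 + Real.log (1 + 1 / θ) ≤ C₁ * N ^ (δ / 2) := by
    refine hlog _ _ hN ?_ ?_
    · have : 0 < 1 / θ := by positivity
      linarith
    · rw [hA, add_mul, one_mul]
      linarith
  have hG0 : 0 ≤ 1 + Real.log (1 + 1 / θ) := by
    have : 0 < 1 / θ := by positivity
    have := Real.log_nonneg (show 1 ≤ 1 + 1 / θ by linarith)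
    linarith
  have hNδ : (N ^ (δ / 2)) ^ 2 = N ^ δ := by
    rw [← Real.rpow_natCast, ← Real.rpow_mul hN0.le]; norm_num
  have hP : D * θ + 1 / θ ^ 2 ≤ C₂ * (D * (Q * μ) ^ ((1 : ℝ) / 6) + 1 / μ ^ ((1 : ℝ) / 3)) := by
    have e1 : θ ≤ κ ^ ((1 : ℝ) / 6) * (Q * μ) ^ ((1 : ℝ) / 6) := by
      rw [← Real.mul_rpow hκ0.le (by nlinarith), hθ]
      gcongr
    have e2 : θ ^ 2 = κ ^ ((1 : ℝ) / 3) * (q * μ) ^ ((1 : ℝ) / 3) := by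
      rw [← Real.mul_rpow hκ0.le (by positivity), hθ, ← Real.rpow_natCast,
        ← Real.rpow_mul hκqμ.le]
      norm_num
    have e3 : 1 / θ ^ 2 ≤ 1 / κ ^ ((1 : ℝ) / 3) * (1 / μ ^ ((1 : ℝ) / 3)) := by
      rw [e2, ← one_div_mul_one_div]
      gcongr
      exact le_mul_of_one_le_left hμ0.le hq1
    have hQμ : 0 ≤ (Q * μ) ^ ((1 : ℝ) / 6) := Real.rpow_nonneg (by nlinarith) _
    calc D * θ + 1 / θ ^ 2 ≤ D * (κ ^ ((1 : ℝ) / 6) * (Q * μ) ^ ((1 : ℝ) / 6)) +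
          1 / κ ^ ((1 : ℝ) / 3) * (1 / μ ^ ((1 : ℝ) / 3)) := by gcongr
      _ = κ ^ ((1 : ℝ) / 6) * (D * (Q * μ) ^ ((1 : ℝ) / 6)) +
          1 / κ ^ ((1 : ℝ) / 3) * (1 / μ ^ ((1 : ℝ) / 3)) := by ring
      _ ≤ C₂ * (D * (Q * μ) ^ ((1 : ℝ) / 6)) + C₂ * (1 / μ ^ ((1 : ℝ) / 3)) := by
          have k1 : 0 < κ ^ ((1 : ℝ) / 6) := by positivity
          have k2 : 0 < 1 / κ ^ ((1 : ℝ) / 3) := by positivity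
          gcongr
          · linarith
          · linarith
      _ = _ := by ring
  calc 600000 * 500 ^ 2 * (1 + Real.log (1 + 1 / θ)) ^ 2 * (D * θ + 1 / θ ^ 2)
      ≤ 600000 * 500 ^ 2 * (C₁ * N ^ (δ / 2)) ^ 2 *
        (C₂ * (D * (Q * μ) ^ ((1 : ℝ) / 6) + 1 / μ ^ ((1 : ℝ) / 3))) := by gcongr
    _ = 600000 * 500 ^ 2 * C₁ ^ 2 * C₂ * (N ^ (δ / 2)) ^ 2 *
        (D * (Q * μ) ^ ((1 : ℝ) / 6) + 1 / μ ^ ((1 : ℝ) / 3)) := by ring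
    _ = _ := by rw [hNδ]

end PowerPhase

section Bilinear

lemma sum_sq_norm_le_of_correlation {X B : Finset ℕ} {w : ℕ → ℂ} {Z : ℕ → ℕ → ℂ} {G T Q : ℝ}
    (hT : 0 ≤ T) (hw : ∀ y ∈ B, ‖w y‖ ≤ G) (hZ : ∀ x ∈ X, ∀ y ∈ B, ‖Z x y‖ ≤ 1)
    (hB : (B.card : ℝ) ≤ Q)
    (hcorr : ∀ y ∈ B, ∀ z ∈ B, z < y → ‖∑ x ∈ X, Z x y * (starRingEnd ℂ) (Z x z)‖ ≤ T) :
    ∑ x ∈ X, ‖∑ y ∈ B, w y * Z x y‖ ^ 2 ≤ G ^ 2 * (B.card * (X.card + Q * T)) := by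
  classical
  have e1 : ((∑ x ∈ X, ‖∑ y ∈ B, w y * Z x y‖ ^ 2 : ℝ) : ℂ) =
      ∑ y ∈ B, ∑ z ∈ B, (w y * (starRingEnd ℂ) (w z)) *
        ∑ x ∈ X, Z x y * (starRingEnd ℂ) (Z x z) := by
    push_cast
    simp only [Finset.mul_sum]
    rw [Finset.sum_congr rfl fun y _ => Finset.sum_comm, Finset.sum_comm]
    refine Finset.sum_congr rfl fun x _ => ?_
    rw [← Complex.mul_conj', map_sum, Finset.sum_mul_sum]
    refine Finset.sum_congr rfl fun y _ => Finset.sum_congr rfl fun z _ => ?_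
    rw [map_mul]; ring
  have hcorr' : ∀ y ∈ B, ∀ z ∈ B, ‖∑ x ∈ X, Z x y * (starRingEnd ℂ) (Z x z)‖ ≤
      (if y = z then (X.card : ℝ) else 0) + T := by
    intro y hy z hz
    rcases lt_trichotomy y z with h | h | h
    · rw [if_neg h.ne, zero_add, ← Complex.norm_conj, map_sum]
      simp only [map_mul, Complex.conj_conj]
      simpa only [mul_comm] using hcorr z hz y hy h
    · rw [if_pos h]
      have : ‖∑ x ∈ X, Z x y * (starRingEnd ℂ) (Z x z)‖ ≤ X.card := by
        refine (norm_sum_le _ _).trans ?_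
        refine (Finset.sum_le_card_nsmul _ _ 1 fun x hx => ?_).trans (by simp)
        rw [norm_mul, Complex.norm_conj]
        exact mul_le_one₀ (hZ x hx y hy) (norm_nonneg _) (hZ x hx z hz)
      linarith
    · rw [if_neg h.ne', zero_add]
      exact hcorr y hy z hz h
  rw [← Real.norm_of_nonneg (Finset.sum_nonneg fun x _ => sq_nonneg _), ← Complex.norm_real, e1]
  refine (norm_sum_le _ _).trans ?_
  have hrow : ∀ y ∈ B, ‖∑ z ∈ B, (w y * (starRingEnd ℂ) (w z)) *
      ∑ x ∈ X, Z x y * (starRingEnd ℂ) (Z x z)‖ ≤ G ^ 2 * (X.card + Q * T) := by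
    intro y hy
    refine (norm_sum_le _ _).trans ?_
    calc ∑ z ∈ B, ‖(w y * (starRingEnd ℂ) (w z)) * ∑ x ∈ X, Z x y * (starRingEnd ℂ) (Z x z)‖
        ≤ ∑ z ∈ B, G ^ 2 * ((if y = z then (X.card : ℝ) else 0) + T) := by
          refine Finset.sum_le_sum fun z hz => ?_
          rw [norm_mul, norm_mul, Complex.norm_conj, sq]
          have hG : 0 ≤ G := (norm_nonneg _).trans (hw y hy)
          exact mul_le_mul (mul_le_mul (hw y hy) (hw z hz) (norm_nonneg _) hG)
            (hcorr' y hy z hz) (norm_nonneg _) (by positivity)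
      _ = G ^ 2 * (X.card + B.card * T) := by
          rw [← Finset.mul_sum, Finset.sum_add_distrib, Finset.sum_ite_eq, if_pos hy]
          simp
      _ ≤ _ := by gcongr
  refine (Finset.sum_le_card_nsmul _ _ _ hrow).trans (le_of_eq ?_)
  rw [nsmul_eq_mul]; ring

/-- Cauchy's inequality for a bilinear form, with the second variable split into blocks. -/
lemma bilinear_sq_le {X Y I : Finset ℕ} {φ : ℕ → ℕ} {u w : ℕ → ℂ} {Z : ℕ → ℕ → ℂ} {G T Q : ℝ}
    (hT : 0 ≤ T) (hφ : ∀ y ∈ Y, φ y ∈ I) (hu : ∀ x ∈ X, ‖u x‖ ≤ G)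
    (hw : ∀ y ∈ Y, ‖w y‖ ≤ G) (hZ : ∀ x ∈ X, ∀ y ∈ Y, ‖Z x y‖ ≤ 1)
    (hB : ∀ i ∈ I, ((Y.filter fun y => φ y = i).card : ℝ) ≤ Q)
    (hcorr : ∀ y ∈ Y, ∀ z ∈ Y, φ y = φ z → z < y →
      ‖∑ x ∈ X, Z x y * (starRingEnd ℂ) (Z x z)‖ ≤ T) :
    ‖∑ x ∈ X, ∑ y ∈ Y, u x * w y * Z x y‖ ^ 2 ≤
      G ^ 4 * X.card * I.card * Y.card * (X.card + Q * T) := by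
  have h1 : ‖∑ x ∈ X, ∑ y ∈ Y, u x * w y * Z x y‖ ≤ ∑ x ∈ X, G * ‖∑ y ∈ Y, w y * Z x y‖ := by
    refine (norm_sum_le _ _).trans (Finset.sum_le_sum fun x hx => ?_)
    simp only [mul_assoc]
    rw [← Finset.mul_sum, norm_mul]
    gcongr
    exact hu x hx
  have h2 : ∀ x ∈ X, ‖∑ y ∈ Y, w y * Z x y‖ ^ 2 ≤
      I.card * ∑ i ∈ I, ‖∑ y ∈ Y.filter (fun y => φ y = i), w y * Z x y‖ ^ 2 := by
    intro x _
    rw [← Finset.sum_fiberwise_of_maps_to hφ]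
    calc _ ≤ (∑ i ∈ I, ‖∑ y ∈ Y.filter (fun y => φ y = i), w y * Z x y‖) ^ 2 := by
          gcongr; exact norm_sum_le _ _
      _ ≤ _ := sq_sum_le_card_mul_sum_sq
  have h3 : ∑ i ∈ I, ∑ x ∈ X, ‖∑ y ∈ Y.filter (fun y => φ y = i), w y * Z x y‖ ^ 2 ≤
      G ^ 2 * (Y.card * (X.card + Q * T)) := by
    calc _ ≤ ∑ i ∈ I, G ^ 2 * ((Y.filter fun y => φ y = i).card * (X.card + Q * T)) := by
          refine Finset.sum_le_sum fun i hi => ?_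
          refine sum_sq_norm_le_of_correlation hT (fun y hy => hw y (Finset.mem_filter.mp hy).1)
            (fun x hx y hy => hZ x hx y (Finset.mem_filter.mp hy).1) (hB i hi) ?_
          intro y hy z hz hzy
          rw [Finset.mem_filter] at hy hz
          exact hcorr y hy.1 z hz.1 (hy.2.trans hz.2.symm) hzy
      _ = _ := by
          rw [← Finset.mul_sum, ← Finset.sum_mul, Finset.card_eq_sum_card_fiberwise hφ]
          push_cast
          rfl
  calc ‖∑ x ∈ X, ∑ y ∈ Y, u x * w y * Z x y‖ ^ 2
      ≤ (∑ x ∈ X, G * ‖∑ y ∈ Y, w y * Z x y‖) ^ 2 := by gcongr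
    _ = G ^ 2 * (∑ x ∈ X, ‖∑ y ∈ Y, w y * Z x y‖) ^ 2 := by rw [← Finset.mul_sum, mul_pow]
    _ ≤ G ^ 2 * (X.card * ∑ x ∈ X, ‖∑ y ∈ Y, w y * Z x y‖ ^ 2) := by
        gcongr; exact sq_sum_le_card_mul_sum_sq
    _ ≤ G ^ 2 * (X.card * ∑ x ∈ X, (I.card *
          ∑ i ∈ I, ‖∑ y ∈ Y.filter (fun y => φ y = i), w y * Z x y‖ ^ 2)) := by
        gcongr with x hx; exact h2 x hx
    _ = G ^ 2 * (X.card * (I.card *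
          ∑ i ∈ I, ∑ x ∈ X, ‖∑ y ∈ Y.filter (fun y => φ y = i), w y * Z x y‖ ^ 2)) := by
        rw [← Finset.mul_sum, Finset.sum_comm]
    _ ≤ G ^ 2 * (X.card * (I.card * (G ^ 2 * (Y.card * (X.card + Q * T))))) := by gcongr
    _ = _ := by ring

lemma exists_sum_ordConnected_eq (A : Finset ℕ) (D : ℕ) (hA : ∀ x ∈ A, D ≤ x ∧ x < 2 * D)
    (hconn : ∀ p ∈ A, ∀ q ∈ A, ∀ r, p ≤ r → r ≤ q → r ∈ A) (g : ℝ → ℂ) :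
    ∃ a b : ℤ, (D : ℤ) ≤ a ∧ b ≤ 2 * D ∧ ∑ x ∈ A, g x = ∑ n ∈ Finset.Ico a b, g n := by
  rcases A.eq_empty_or_nonempty with rfl | hne
  · exact ⟨D, D, le_rfl, by omega, by simp⟩
  have h1 := hA _ (A.min'_mem hne)
  have h2 := hA _ (A.max'_mem hne)
  refine ⟨(A.min' hne : ℕ), (A.max' hne : ℕ) + 1, by omega, by omega, ?_⟩
  have hAeq : Finset.Ico ((A.min' hne : ℕ) : ℤ) ((A.max' hne : ℕ) + 1) =
      A.map Nat.castEmbedding := by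
    ext n
    rw [Finset.mem_Ico, Finset.mem_map]
    constructor
    · rintro ⟨h3, h4⟩
      obtain ⟨k, rfl⟩ := Int.eq_ofNat_of_zero_le (show 0 ≤ n by omega)
      exact ⟨k, hconn _ (A.min'_mem hne) _ (A.max'_mem hne) k (by omega) (by omega), rfl⟩
    · rintro ⟨k, hk, rfl⟩
      have h3 := A.min'_le k hk
      have h4 := A.le_max' k hk
      simp only [Nat.castEmbedding_apply]
      omega
  rw [hAeq, Finset.sum_map]
  simp

end Bilinear

section DyadicBlock

/-- The phase of the bilinear sum, cut off to the summation region; `t` measures the gap required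
between the two variables. -/
noncomputable def cutPhase (γ β M N₁ N₂ ϑ : ℝ) (t x y : ℕ) : ℂ :=
  if (N₁ < (x : ℝ) * y ∧ (x : ℝ) * y ≤ N₂) ∧ (ϑ < x ∧ ϑ < y) ∧ y + t ≤ x then
    e2pi (β * (x : ℝ) ^ 2 * (y : ℝ) ^ 2 - M * (x : ℝ) ^ γ * (y : ℝ) ^ γ) else 0

lemma norm_cutPhase_le (γ β M N₁ N₂ ϑ : ℝ) (t x y : ℕ) :
    ‖cutPhase γ β M N₁ N₂ ϑ t x y‖ ≤ 1 := by
  rw [cutPhase]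
  split_ifs
  · rw [norm_e2pi]
  · simp

lemma exists_sum_cutPhase_eq (γ β M N₁ N₂ ϑ : ℝ) (t D y z : ℕ) :
    ∃ a b : ℤ, (D : ℤ) ≤ a ∧ b ≤ 2 * D ∧
      ∑ x ∈ Finset.Ico D (2 * D), cutPhase γ β M N₁ N₂ ϑ t x y *
        (starRingEnd ℂ) (cutPhase γ β M N₁ N₂ ϑ t x z) =
      ∑ x ∈ Finset.Ico a b, e2pi
        ((β * (x : ℝ) ^ 2 * (y : ℝ) ^ 2 - M * (x : ℝ) ^ γ * (y : ℝ) ^ γ) -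
          (β * (x : ℝ) ^ 2 * (z : ℝ) ^ 2 - M * (x : ℝ) ^ γ * (z : ℝ) ^ γ)) := by
  classical
  set A : Finset ℕ := (Finset.Ico D (2 * D)).filter fun x : ℕ =>
    ((N₁ < (x : ℝ) * y ∧ (x : ℝ) * y ≤ N₂) ∧ (ϑ < x ∧ ϑ < y) ∧ y + t ≤ x) ∧
    ((N₁ < (x : ℝ) * z ∧ (x : ℝ) * z ≤ N₂) ∧ (ϑ < x ∧ ϑ < z) ∧ z + t ≤ x) with hA
  obtain ⟨a, b, ha, hb, hab⟩ := exists_sum_ordConnected_eq A D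
    (fun x hx => Finset.mem_Ico.mp (Finset.mem_filter.mp hx).1)
    (by
      intro p hp q hq r hpr hrq
      rw [hA, Finset.mem_filter, Finset.mem_Ico] at hp hq ⊢
      obtain ⟨⟨p1, p2⟩, ⟨⟨p3, p4⟩, ⟨p5, p6⟩, p7⟩, ⟨⟨p8, p9⟩, ⟨p10, p11⟩, p12⟩⟩ := hp
      obtain ⟨⟨q1, q2⟩, ⟨⟨q3, q4⟩, ⟨q5, q6⟩, q7⟩, ⟨⟨q8, q9⟩, ⟨q10, q11⟩, q12⟩⟩ := hq
      have h1 : (p : ℝ) ≤ r := by exact_mod_cast hpr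
      have h2 : (r : ℝ) ≤ q := by exact_mod_cast hrq
      have hy : (0 : ℝ) ≤ y := Nat.cast_nonneg y
      have hz : (0 : ℝ) ≤ z := Nat.cast_nonneg z
      have m1 : (p : ℝ) * y ≤ r * y := by gcongr
      have m2 : (p : ℝ) * z ≤ r * z := by gcongr
      have m3 : (r : ℝ) * y ≤ q * y := by gcongr
      have m4 : (r : ℝ) * z ≤ q * z := by gcongr
      exact ⟨⟨by omega, by omega⟩, ⟨⟨by linarith, by linarith⟩, ⟨by linarith, p6⟩, by omega⟩,
        ⟨⟨by linarith, by linarith⟩, ⟨by linarith, p11⟩, by omega⟩⟩)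
    (fun x => e2pi ((β * x ^ 2 * (y : ℝ) ^ 2 - M * x ^ γ * (y : ℝ) ^ γ) -
          (β * x ^ 2 * (z : ℝ) ^ 2 - M * x ^ γ * (z : ℝ) ^ γ)))
  refine ⟨a, b, ha, hb, ?_⟩
  rw [← hab, hA, Finset.sum_filter]
  refine Finset.sum_congr rfl fun x _ => ?_
  rw [cutPhase, cutPhase]
  by_cases h1 : (N₁ < (x : ℝ) * y ∧ (x : ℝ) * y ≤ N₂) ∧ (ϑ < x ∧ ϑ < y) ∧ y + t ≤ x
  · by_cases h2 : (N₁ < (x : ℝ) * z ∧ (x : ℝ) * z ≤ N₂) ∧ (ϑ < x ∧ ϑ < z) ∧ z + t ≤ x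
    · rw [if_pos h1, if_pos h2, if_pos ⟨h1, h2⟩, conj_e2pi, ← e2pi_add, ← sub_eq_add_neg]
    · rw [if_neg h2, map_zero, mul_zero]
      exact (if_neg fun h => h2 h.2).symm
  · rw [if_neg h1, zero_mul]
    exact (if_neg fun h => h1 h.1).symm

set_option maxHeartbeats 1000000 in
lemma dyadic_block_bound (γ δ : ℝ) (hγ0 : 0 < γ) (hγ1 : γ < 1) (hδ : 0 < δ) :
    ∃ C > 0, ∀ (β M N N₁ N₂ ϑ G : ℝ) (t D : ℕ) (u w : ℕ → ℂ), 1 ≤ N → 1 ≤ M →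
      M ≤ N₁ ^ (2 - γ) → 1 ≤ N₁ → N₂ ≤ 2 * N₁ → N₂ ≤ N → N ^ ((3 : ℝ) / 7) ≤ ϑ → 0 < D →
      (∀ n, ‖u n‖ ≤ G) → (∀ n, ‖w n‖ ≤ G) →
      ‖∑ x ∈ Finset.Ico D (2 * D), ∑ y ∈ Finset.Icc 1 ⌊N₂⌋₊,
          u x * w y * cutPhase γ β M N₁ N₂ ϑ t x y‖ ^ 2 ≤
        C * G ^ 4 * N ^ δ * (M ^ ((1 : ℝ) / 7) * N₁ ^ (γ / 7 + 12 / 7) +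
          N₁ ^ (13 / 6 - γ / 3)) := by
  obtain ⟨C, hC, hmain⟩ := power_phase_sum_bound γ δ hγ0 hγ1 hδ
  refine ⟨16 * (1 + 2 * C) * 2, by positivity, ?_⟩
  intro β M N N₁ N₂ ϑ G t D u w hN hM hMN hN₁ hN₂ hN₂N hϑ hD hu hw
  have hN0 : 0 < N := by linarith
  have hM0 : 0 < M := by linarith
  have hN₁0 : 0 < N₁ := by linarith
  have hG : 0 ≤ G := (norm_nonneg _).trans (hu 0)
  set Z := cutPhase γ β M N₁ N₂ ϑ t with hZ
  by_cases hex : ∃ x ∈ Finset.Ico D (2 * D), ∃ y ∈ Finset.Icc 1 ⌊N₂⌋₊, Z x y ≠ 0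
  swap
  · push Not at hex
    rw [Finset.sum_eq_zero fun x hx => Finset.sum_eq_zero fun y hy => by
      rw [hex x hx y hy, mul_zero], norm_zero, zero_pow two_ne_zero]
    positivity
  have hcond : ∀ x y, Z x y ≠ 0 →
      (N₁ < (x : ℝ) * y ∧ (x : ℝ) * y ≤ N₂) ∧ (ϑ < x ∧ ϑ < y) ∧ y + t ≤ x := by
    intro x y h
    by_contra h'
    exact h (by rw [hZ, cutPhase, if_neg h'])
  obtain ⟨x₀, hx₀, y₀, hy₀, hxy⟩ := hex
  obtain ⟨⟨c1, c2⟩, ⟨c3, c4⟩, c5⟩ := hcond _ _ hxy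
  rw [Finset.mem_Ico] at hx₀
  rw [Finset.mem_Icc] at hy₀
  have hD1 : (1 : ℝ) ≤ D := by exact_mod_cast hD
  have hD0 : (0 : ℝ) < D := by linarith
  have hDx : (D : ℝ) ≤ x₀ := by exact_mod_cast hx₀.1
  have hxD : (x₀ : ℝ) ≤ 2 * D := by exact_mod_cast hx₀.2.le
  have hyx : (y₀ : ℝ) ≤ x₀ := by exact_mod_cast (by omega : y₀ ≤ x₀)
  have hy1 : (1 : ℝ) ≤ y₀ := by exact_mod_cast hy₀.1
  have hx₀0 : (0 : ℝ) ≤ x₀ := Nat.cast_nonneg x₀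
  have hDN : (D : ℝ) ≤ N := by
    have := le_mul_of_one_le_right hx₀0 hy1
    linarith
  have hDN₁ : N₁ ≤ 4 * (D : ℝ) ^ 2 := by
    calc N₁ ≤ (x₀ : ℝ) * y₀ := c1.le
      _ ≤ (2 * D) * (2 * D) := by gcongr; exact hyx.trans hxD
      _ = 4 * (D : ℝ) ^ 2 := by ring
  have hN₁N : N₁ ≤ N := by linarith
  set L : ℝ := N₁ / D with hL
  have hL0 : 0 < L := by positivity
  have hDL : D * L = N₁ := by rw [hL]; field_simp
  have hyL : (y₀ : ℝ) ≤ 2 * L := by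
    rw [hL, mul_div_assoc', le_div_iff₀ hD0, mul_comm]
    have : (D : ℝ) * y₀ ≤ x₀ * y₀ := by gcongr
    linarith
  have hN37 : N ^ ((3 : ℝ) / 7) ≤ 2 * L := by linarith
  set μ : ℝ := M * L ^ (γ - 1) * (D : ℝ) ^ (γ - 3) with hμ
  have hμ0 : 0 < μ := by positivity
  have hμeq : μ = M * N₁ ^ (γ - 1) / (D : ℝ) ^ 2 := by
    rw [hμ, hL, Real.div_rpow hN₁0.le hD0.le, show γ - 3 = (γ - 1) - 2 by ring,
      Real.rpow_sub hD0 (γ - 1) 2, Real.rpow_two]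
    field_simp
  have hμ4 : μ ≤ 4 := by
    rw [hμeq, div_le_iff₀ (by positivity)]
    calc M * N₁ ^ (γ - 1) ≤ N₁ ^ (2 - γ) * N₁ ^ (γ - 1) := by gcongr
      _ = N₁ := by
        rw [← Real.rpow_add hN₁0, show 2 - γ + (γ - 1) = 1 by ring, Real.rpow_one]
      _ ≤ 4 * (D : ℝ) ^ 2 := hDN₁
  have hμinv : 1 / μ = (D : ℝ) ^ 2 * N₁ ^ (1 - γ) / M := by
    rw [hμeq, one_div_div, show γ - 1 = -(1 - γ) by ring, Real.rpow_neg hN₁0.le]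
    field_simp
  have hμN : 1 / μ ≤ N ^ 3 := by
    rw [hμinv, div_le_iff₀ hM0]
    calc (D : ℝ) ^ 2 * N₁ ^ (1 - γ) ≤ N ^ 2 * N := by
          gcongr
          calc N₁ ^ (1 - γ) ≤ N₁ ^ (1 : ℝ) := Real.rpow_le_rpow_of_exponent_le hN₁ (by linarith)
            _ = N₁ := Real.rpow_one _
            _ ≤ N := hN₁N
      _ = N ^ 3 * 1 := by ring
      _ ≤ N ^ 3 * M := by gcongr
  set ν : ℝ := μ ^ ((1 : ℝ) / 7) with hν
  have hν0 : 0 < ν := by positivity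
  have hν7 : ν ^ 7 = μ := by
    rw [hν, ← Real.rpow_natCast, ← Real.rpow_mul hμ0.le]; norm_num
  have hν2 : ν ≤ 2 := by
    by_contra! h
    have : (2 : ℝ) ^ 7 < ν ^ 7 := by gcongr
    rw [hν7] at this
    linarith
  have hνL : 1 / ν ≤ 2 * L := by
    refine le_trans ?_ hN37
    have e : 1 / ν = (1 / μ) ^ ((1 : ℝ) / 7) := by
      rw [hν, Real.div_rpow zero_le_one hμ0.le, Real.one_rpow]
    have e2 : N ^ ((3 : ℝ) / 7) = (N ^ 3) ^ ((1 : ℝ) / 7) := by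
      rw [← Real.rpow_natCast, ← Real.rpow_mul hN0.le]; norm_num
    rw [e, e2]
    gcongr
  set Q : ℕ := ⌈1 / ν⌉₊ with hQ
  have hQ1 : 1 / ν ≤ Q := Nat.le_ceil _
  have hQ2 : (Q : ℝ) ≤ 3 * (1 / ν) := by
    have h1 := (Nat.ceil_lt_add_one (show 0 ≤ 1 / ν by positivity)).le
    have h2 : 1 / 2 ≤ 1 / ν := one_div_le_one_div_of_le hν0 hν2
    rw [← hQ] at h1
    linarith
  have hQ0 : (0 : ℝ) < Q := lt_of_lt_of_le (by positivity) hQ1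
  have hQpos : 0 < Q := by exact_mod_cast hQ0
  set X := Finset.Ico D (2 * D) with hX
  set Y := (Finset.Icc 1 ⌊2 * L⌋₊).filter (fun y : ℕ => L / 2 < y) with hY
  set I := Finset.range (⌊2 * L⌋₊ / Q + 1) with hI
  have hXc : (X.card : ℝ) = D := by
    rw [hX, Nat.card_Ico, two_mul, Nat.add_sub_cancel]
  have hfl : ((⌊2 * L⌋₊ : ℕ) : ℝ) ≤ 2 * L := Nat.floor_le (by positivity)
  have hYc : (Y.card : ℝ) ≤ 2 * L := by
    refine le_trans ?_ hfl
    have := Finset.card_filter_le (Finset.Icc 1 ⌊2 * L⌋₊) (fun y : ℕ => L / 2 < y)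
    rw [Nat.card_Icc, Nat.add_sub_cancel] at this
    exact_mod_cast this
  have hIc : (I.card : ℝ) ≤ 8 * L / Q := by
    rw [hI, Finset.card_range]
    push_cast
    have h1 : ((⌊2 * L⌋₊ / Q : ℕ) : ℝ) ≤ 2 * L / Q := by
      refine Nat.cast_div_le.trans ?_
      gcongr
    have h2 : 1 ≤ 6 * L / Q := by
      rw [le_div_iff₀ hQ0]; linarith
    have h3 : 8 * L / Q = 2 * L / Q + 6 * L / Q := by ring
    linarith
  have hsumeq : ∑ x ∈ X, ∑ y ∈ Finset.Icc 1 ⌊N₂⌋₊, u x * w y * Z x y =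
      ∑ x ∈ X, ∑ y ∈ Y, u x * w y * Z x y := by
    refine Finset.sum_congr rfl fun x hx => ?_
    rw [hX, Finset.mem_Ico] at hx
    have hx1 : (D : ℝ) ≤ x := by exact_mod_cast hx.1
    have hx2 : (x : ℝ) < 2 * D := by exact_mod_cast hx.2
    have hkey : ∀ y : ℕ, Z x y ≠ 0 → y ∈ Y ∧ y ∈ Finset.Icc 1 ⌊N₂⌋₊ := by
      intro y hy
      obtain ⟨⟨d1, d2⟩, ⟨d3, d4⟩, d5⟩ := hcond _ _ hy
      have hϑ0 : 0 < ϑ := lt_of_lt_of_le (by positivity) hϑ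
      have hy0 : (0 : ℝ) < y := by linarith
      have hy1 : 1 ≤ y := by exact_mod_cast hy0
      have hDy : (D : ℝ) * y ≤ x * y := by gcongr
      have hyD : (y : ℝ) ≤ D * y := le_mul_of_one_le_left hy0.le hD1
      have hyN : (y : ℝ) ≤ N₂ := by linarith
      have hy2 : (y : ℝ) ≤ 2 * L := by
        rw [hL, mul_div_assoc', le_div_iff₀ hD0, mul_comm]
        linarith
      have hy3 : L / 2 < y := by
        rw [hL, div_div, div_lt_iff₀ (by positivity), mul_comm (y : ℝ), mul_comm (D : ℝ)]
        have : (x : ℝ) * y ≤ 2 * D * y := by gcongr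
        linarith
      exact ⟨Finset.mem_filter.mpr ⟨Finset.mem_Icc.mpr ⟨hy1, Nat.le_floor hy2⟩, hy3⟩,
        Finset.mem_Icc.mpr ⟨hy1, Nat.le_floor hyN⟩⟩
    have hz : ∀ y, u x * w y * Z x y ≠ 0 → Z x y ≠ 0 := fun y h => right_ne_zero_of_mul h
    rw [← Finset.sum_filter_ne_zero, ← Finset.sum_filter_ne_zero (s := Y)]
    refine Finset.sum_congr ?_ fun _ _ => rfl
    ext y
    simp only [Finset.mem_filter]
    exact ⟨fun h => ⟨(hkey y (hz y h.2)).1, h.2⟩, fun h => ⟨(hkey y (hz y h.2)).2, h.2⟩⟩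
  rw [hsumeq]
  set T : ℝ := C * N ^ δ * (D * (Q * μ) ^ ((1 : ℝ) / 6) + 1 / μ ^ ((1 : ℝ) / 3)) with hT
  have hT0 : 0 ≤ T := by positivity
  have hbil := bilinear_sq_le (X := X) (Y := Y) (I := I) (φ := fun y => y / Q) (u := u) (w := w)
    (Z := Z) (G := G) (T := T) (Q := Q) hT0
    (fun y hy => by
      have := (Finset.mem_Icc.mp (Finset.mem_filter.mp hy).1).2
      rw [hI, Finset.mem_range]
      exact Nat.lt_succ_of_le (Nat.div_le_div_right this))
    (fun x _ => hu x) (fun y _ => hw y) (fun x _ y _ => norm_cutPhase_le _ _ _ _ _ _ _ _ _)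
    (fun i _ => by
      have hsub : Y.filter (fun y => y / Q = i) ⊆ Finset.Ico (Q * i) (Q * i + Q) := by
        intro y hy
        have h1 := (Finset.mem_filter.mp hy).2
        have h2 := Nat.div_add_mod y Q
        have h3 := Nat.mod_lt y hQpos
        rw [h1] at h2
        rw [Finset.mem_Ico]
        omega
      have := Finset.card_le_card hsub
      rw [Nat.card_Ico, Nat.add_sub_cancel_left] at this
      exact_mod_cast this)
    (by
      intro y hy z hz hyz hzy
      obtain ⟨a, b, ha, hb, hab⟩ := exists_sum_cutPhase_eq γ β M N₁ N₂ ϑ t D y z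
      rw [hZ, hX, hab]
      rw [hY, Finset.mem_filter, Finset.mem_Icc] at hy hz
      have hyL : (y : ℝ) ≤ 2 * L := (Nat.le_floor_iff (by positivity)).mp hy.1.2
      refine hmain β M N L D y z μ Q a b hM0 hN hL0 hD1 hz.2 (by exact_mod_cast hzy) hyL
        (by exact_mod_cast ha) (by exact_mod_cast hb) hμ ?_ ?_
      · have : 0 < N ^ 3 := by positivity
        linarith
      · have h2 := Nat.div_add_mod y Q
        have h3 := Nat.mod_lt y hQpos
        have h4 := Nat.div_add_mod z Q
        have h5 : y / Q = z / Q := hyz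
        rw [h5] at h2
        have h6 : y ≤ Q + z := by omega
        have h7 : (y : ℝ) ≤ Q + z := by exact_mod_cast h6
        linarith)
  refine hbil.trans ?_
  have hNδ : 1 ≤ N ^ δ := Real.one_le_rpow hN hδ.le
  have hQμ : (Q * μ) ^ ((1 : ℝ) / 6) ≤ 2 * ν := by
    have h1 : Q * μ ≤ (2 * ν) ^ 6 := by
      calc Q * μ ≤ 3 * (1 / ν) * ν ^ 7 := by rw [hν7]; gcongr
        _ = 3 * ν ^ 6 := by field_simp
        _ ≤ 64 * ν ^ 6 := by gcongr; norm_num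
        _ = (2 * ν) ^ 6 := by ring
    calc (Q * μ) ^ ((1 : ℝ) / 6) ≤ ((2 * ν) ^ 6) ^ ((1 : ℝ) / 6) := by gcongr
      _ = 2 * ν := by
        rw [← Real.rpow_natCast, ← Real.rpow_mul (by positivity)]; norm_num
  have hDQ : (D : ℝ) / Q ≤ D * ν := by
    rw [div_le_iff₀ hQ0]
    rw [div_le_iff₀ hν0] at hQ1
    calc (D : ℝ) = D * 1 := (mul_one _).symm
      _ ≤ D * (Q * ν) := by gcongr
      _ = D * ν * Q := by ring
  have hN₁sq : N₁ ^ (2 : ℝ) = (D * L) ^ 2 := by rw [hDL, Real.rpow_two]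
  have hb1 : (D : ℝ) ^ 2 * L ^ 2 * ν ≤ 2 * (M ^ ((1 : ℝ) / 7) * N₁ ^ (γ / 7 + 12 / 7)) := by
    have h1 : μ ≤ 2 ^ 7 * (M * N₁ ^ (γ - 2)) := by
      have e : N₁ ^ (γ - 2) = N₁ ^ (γ - 1) / N₁ := by
        rw [show γ - 2 = (γ - 1) - 1 by ring, Real.rpow_sub_one hN₁0.ne']
      rw [hμeq, div_le_iff₀ (by positivity), e]
      have h2 : 1 ≤ 4 * (D : ℝ) ^ 2 / N₁ := by rwa [le_div_iff₀ hN₁0, one_mul]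
      have h3 : 0 < M * N₁ ^ (γ - 1) := by positivity
      calc M * N₁ ^ (γ - 1) ≤ M * N₁ ^ (γ - 1) * (4 * (D : ℝ) ^ 2 / N₁) :=
            le_mul_of_one_le_right h3.le h2
        _ = 4 * (M * (N₁ ^ (γ - 1) / N₁) * (D : ℝ) ^ 2) := by ring
        _ ≤ 2 ^ 7 * (M * (N₁ ^ (γ - 1) / N₁) * (D : ℝ) ^ 2) := by gcongr; norm_num
        _ = _ := by ring
    have h2 : ν ≤ 2 * (M ^ ((1 : ℝ) / 7) * N₁ ^ ((γ - 2) / 7)) := by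
      calc ν ≤ (2 ^ 7 * (M * N₁ ^ (γ - 2))) ^ ((1 : ℝ) / 7) := by rw [hν]; gcongr
        _ = _ := by
          rw [Real.mul_rpow (by positivity) (by positivity), Real.mul_rpow hM0.le (by positivity),
            ← Real.rpow_mul hN₁0.le, ← Real.rpow_natCast, ← Real.rpow_mul (by norm_num),
            ← div_eq_mul_one_div (γ - 2) 7]
          norm_num
    calc (D : ℝ) ^ 2 * L ^ 2 * ν = N₁ ^ (2 : ℝ) * ν := by rw [hN₁sq]; ring
      _ ≤ N₁ ^ (2 : ℝ) * (2 * (M ^ ((1 : ℝ) / 7) * N₁ ^ ((γ - 2) / 7))) := by gcongr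
      _ = 2 * (M ^ ((1 : ℝ) / 7) * (N₁ ^ (2 : ℝ) * N₁ ^ ((γ - 2) / 7))) := by ring
      _ = _ := by
        rw [← Real.rpow_add hN₁0]
        ring_nf
  have hb2 : D * L ^ 2 * (1 / μ ^ ((1 : ℝ) / 3)) ≤ 2 * N₁ ^ (13 / 6 - γ / 3) := by
    have h1 : 1 / μ ^ ((1 : ℝ) / 3) ≤ (D : ℝ) ^ ((2 : ℝ) / 3) * N₁ ^ ((1 - γ) / 3) := by
      have e : 1 / μ ^ ((1 : ℝ) / 3) = (1 / μ) ^ ((1 : ℝ) / 3) := by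
        rw [Real.div_rpow zero_le_one hμ0.le, Real.one_rpow]
      have e2 : 1 / μ ≤ (D : ℝ) ^ 2 * N₁ ^ (1 - γ) := by
        rw [hμinv]
        exact div_le_self (by positivity) hM
      rw [e]
      calc (1 / μ) ^ ((1 : ℝ) / 3) ≤ ((D : ℝ) ^ 2 * N₁ ^ (1 - γ)) ^ ((1 : ℝ) / 3) := by gcongr
        _ = _ := by
          rw [Real.mul_rpow (by positivity) (by positivity), ← Real.rpow_natCast,
            ← Real.rpow_mul hD0.le, ← Real.rpow_mul hN₁0.le]
          congr 2
          · norm_num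
          · ring
    have h2 : N₁ ^ ((1 : ℝ) / 6) ≤ 2 * (D : ℝ) ^ ((1 : ℝ) / 3) := by
      calc N₁ ^ ((1 : ℝ) / 6) ≤ (4 * (D : ℝ) ^ 2) ^ ((1 : ℝ) / 6) := by gcongr
        _ ≤ (2 ^ 6 * (D : ℝ) ^ 2) ^ ((1 : ℝ) / 6) := by gcongr; norm_num
        _ = _ := by
          rw [Real.mul_rpow (by positivity) (by positivity), ← Real.rpow_natCast,
            ← Real.rpow_natCast, ← Real.rpow_mul hD0.le, ← Real.rpow_mul (by norm_num)]
          norm_num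
    have h3 : (D : ℝ) ^ ((2 : ℝ) / 3) * N₁ ^ ((1 : ℝ) / 6) ≤ 2 * D := by
      calc (D : ℝ) ^ ((2 : ℝ) / 3) * N₁ ^ ((1 : ℝ) / 6)
          ≤ (D : ℝ) ^ ((2 : ℝ) / 3) * (2 * (D : ℝ) ^ ((1 : ℝ) / 3)) := by gcongr
        _ = 2 * ((D : ℝ) ^ ((2 : ℝ) / 3) * (D : ℝ) ^ ((1 : ℝ) / 3)) := by ring
        _ = 2 * D := by rw [← Real.rpow_add hD0]; norm_num
    have h4 : (D : ℝ) ^ ((2 : ℝ) / 3) ≤ 2 * D * N₁ ^ (-(1 : ℝ) / 6) := by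
      rw [neg_div, Real.rpow_neg hN₁0.le, ← div_eq_mul_inv, le_div_iff₀ (by positivity)]
      exact h3
    calc D * L ^ 2 * (1 / μ ^ ((1 : ℝ) / 3))
        ≤ D * L ^ 2 * ((2 * D * N₁ ^ (-(1 : ℝ) / 6)) * N₁ ^ ((1 - γ) / 3)) := by
          gcongr
          exact h1.trans (by gcongr)
      _ = 2 * (N₁ ^ (2 : ℝ) * N₁ ^ (-(1 : ℝ) / 6) * N₁ ^ ((1 - γ) / 3)) := by
          rw [hN₁sq]; ring
      _ = _ := by
        rw [← Real.rpow_add hN₁0, ← Real.rpow_add hN₁0]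
        ring_nf
  have hTle : (D : ℝ) / Q + T ≤
      (1 + 2 * C) * N ^ δ * (D * ν + 1 / μ ^ ((1 : ℝ) / 3)) := by
    have p1 : 0 ≤ 1 / μ ^ ((1 : ℝ) / 3) := by positivity
    have p2 : 0 ≤ D * ν := by positivity
    calc (D : ℝ) / Q + T ≤ N ^ δ * (D * ν) +
          C * N ^ δ * (D * (2 * ν) + 2 * (1 / μ ^ ((1 : ℝ) / 3))) := by
          refine add_le_add (hDQ.trans (le_mul_of_one_le_left p2 hNδ)) ?_
          rw [hT]
          gcongr
          linarith
      _ ≤ N ^ δ * (D * ν + 1 / μ ^ ((1 : ℝ) / 3)) +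
          C * N ^ δ * (D * (2 * ν) + 2 * (1 / μ ^ ((1 : ℝ) / 3))) := by
          gcongr
          linarith
      _ = _ := by ring
  calc G ^ 4 * X.card * I.card * Y.card * (X.card + Q * T)
      ≤ G ^ 4 * D * (8 * L / Q) * (2 * L) * (D + Q * T) := by
        rw [hXc]
        gcongr
    _ = 16 * G ^ 4 * D * L ^ 2 * (D / Q + T) := by field_simp; ring
    _ ≤ 16 * G ^ 4 * D * L ^ 2 *
        ((1 + 2 * C) * N ^ δ * (D * ν + 1 / μ ^ ((1 : ℝ) / 3))) := by gcongr
    _ = 16 * (1 + 2 * C) * G ^ 4 * N ^ δ *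
        ((D : ℝ) ^ 2 * L ^ 2 * ν + D * L ^ 2 * (1 / μ ^ ((1 : ℝ) / 3))) := by ring
    _ ≤ 16 * (1 + 2 * C) * G ^ 4 * N ^ δ *
        (2 * (M ^ ((1 : ℝ) / 7) * N₁ ^ (γ / 7 + 12 / 7)) + 2 * N₁ ^ (13 / 6 - γ / 3)) := by
        gcongr
    _ = _ := by ring

end DyadicBlock

section DivisorBound

lemma natCast_add_one_le_mul_pow {r : ℝ} (hr : 0 < r) (e : ℕ) :
    (e : ℝ) + 1 ≤ (1 + 1 / r) * (1 + r) ^ e := by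
  have h1 := one_add_mul_le_pow (show -2 ≤ r by linarith) e
  calc (e : ℝ) + 1 ≤ e + 1 + (e * r + 1 / r) := by
        have : 0 ≤ e * r + 1 / r := by positivity
        linarith
    _ = (1 + 1 / r) * (1 + e * r) := by field_simp; ring
    _ ≤ _ := by gcongr

/-- The divisor bound: the number of divisors of `n` is `O(n ^ η)` for every `η > 0`. -/
lemma exists_card_divisors_le {η : ℝ} (hη : 0 < η) :
    ∃ C > 0, ∀ n : ℕ, n ≠ 0 → (n.divisors.card : ℝ) ≤ C * (n : ℝ) ^ η := by
  have h2 : 1 < (2 : ℝ) ^ η := Real.one_lt_rpow one_lt_two hη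
  set r : ℝ := 2 ^ η - 1 with hr
  have hr0 : 0 < r := by linarith
  set B : ℝ := 1 + 1 / r with hB
  have hB1 : 1 ≤ B := by
    have : 0 < 1 / r := by positivity
    linarith
  set K : ℕ := ⌈(2 : ℝ) ^ (1 / η)⌉₊ with hK
  refine ⟨B ^ K, by positivity, fun n hn => ?_⟩
  have hfac : ∀ p ∈ n.primeFactors, ((n.factorization p : ℝ) + 1) ≤
      (if p < K then B else 1) * ((p : ℝ) ^ n.factorization p) ^ η := by
    intro p hp
    have hp2 : (2 : ℝ) ≤ p := by exact_mod_cast (Nat.prime_of_mem_primeFactors hp).two_le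
    have hpe : ((p : ℝ) ^ n.factorization p) ^ η = ((p : ℝ) ^ η) ^ n.factorization p := by
      rw [← Real.rpow_natCast, ← Real.rpow_mul (by linarith), mul_comm, Real.rpow_mul (by linarith),
        Real.rpow_natCast]
    rw [hpe]
    split_ifs with h
    · refine (natCast_add_one_le_mul_pow hr0 _).trans ?_
      gcongr
      rw [hr, add_sub_cancel]
      gcongr
    · have h3 : (2 : ℝ) ≤ (p : ℝ) ^ η := by
        have h4 : (2 : ℝ) ^ (1 / η) ≤ p := (Nat.le_ceil _).trans (by exact_mod_cast not_lt.mp h)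
        calc (2 : ℝ) = (2 ^ (1 / η)) ^ η := by
              rw [← Real.rpow_mul zero_le_two, one_div_mul_cancel hη.ne', Real.rpow_one]
          _ ≤ (p : ℝ) ^ η := by gcongr
      rw [one_mul]
      calc (n.factorization p : ℝ) + 1 ≤ 2 ^ n.factorization p := by
            exact_mod_cast Nat.lt_two_pow_self
        _ ≤ _ := by gcongr
  have hnprod : (n : ℝ) = ∏ p ∈ n.primeFactors, (p : ℝ) ^ n.factorization p := by
    conv_lhs => rw [← Nat.prod_factorization_pow_eq_self hn]
    rw [Finsupp.prod, Nat.support_factorization]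
    push_cast
    rfl
  have hcard : (n.primeFactors.filter (· < K)).card ≤ K := by
    calc _ ≤ (Finset.range K).card := Finset.card_le_card fun p hp =>
          Finset.mem_range.mpr (Finset.mem_filter.mp hp).2
      _ = K := Finset.card_range K
  calc (n.divisors.card : ℝ) = ∏ p ∈ n.primeFactors, ((n.factorization p : ℝ) + 1) := by
        rw [Nat.card_divisors hn]; push_cast; rfl
    _ ≤ ∏ p ∈ n.primeFactors, ((if p < K then B else 1) * ((p : ℝ) ^ n.factorization p) ^ η) :=
        Finset.prod_le_prod (fun p _ => by positivity) hfac
    _ = B ^ (n.primeFactors.filter (· < K)).card * (n : ℝ) ^ η := by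
        rw [Finset.prod_mul_distrib, Real.finsetProd_rpow _ _ fun p _ => by positivity,
          ← hnprod, Finset.prod_ite, Finset.prod_const, Finset.prod_const_one, mul_one]
    _ ≤ _ := by gcongr

end DivisorBound

section DyadicSum

lemma sum_Ico_two_pow {E : Type*} [AddCommMonoid E] (F : ℕ → E) (J : ℕ) :
    ∑ x ∈ Finset.Ico 1 (2 ^ J), F x =
      ∑ j ∈ Finset.range J, ∑ x ∈ Finset.Ico (2 ^ j) (2 * 2 ^ j), F x := by
  induction J with
  | zero => simp
  | succ J ih =>
    rw [Finset.sum_range_succ, ← ih, pow_succ', Finset.sum_Ico_consecutive]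
    · exact Nat.one_le_two_pow
    · omega

lemma cutPhase_sum_bound (γ δ : ℝ) (hγ0 : 0 < γ) (hγ1 : γ < 1) (hδ : 0 < δ) :
    ∃ C > 0, ∀ (β M N N₁ N₂ ϑ G : ℝ) (t : ℕ) (u w : ℕ → ℂ), 1 ≤ N → 1 ≤ M →
      M ≤ N₁ ^ (2 - γ) → 1 ≤ N₁ → N₂ ≤ 2 * N₁ → N₂ ≤ N → N ^ ((3 : ℝ) / 7) ≤ ϑ →
      (∀ n, ‖u n‖ ≤ G) → (∀ n, ‖w n‖ ≤ G) →
      ‖∑ x ∈ Finset.Icc 1 ⌊N₂⌋₊, ∑ y ∈ Finset.Icc 1 ⌊N₂⌋₊,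
          u x * w y * cutPhase γ β M N₁ N₂ ϑ t x y‖ ≤
        C * G ^ 2 * N ^ δ * (M ^ ((1 : ℝ) / 14) * N₁ ^ (γ / 14 + 6 / 7) +
          N₁ ^ (13 / 12 - γ / 6)) := by
  obtain ⟨C, hC, hblock⟩ := dyadic_block_bound γ δ hγ0 hγ1 hδ
  obtain ⟨C', hC', hlog⟩ := exists_one_add_log_le 2 (half_pos hδ)
  refine ⟨2 * C' * √C, by positivity, ?_⟩
  intro β M N N₁ N₂ ϑ G t u w hN hM hMN hN₁ hN₂ hN₂N hϑ hu hw
  have hN0 : 0 < N := by linarith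
  have hM0 : 0 < M := by linarith
  have hN₁0 : 0 < N₁ := by linarith
  obtain ⟨J, hJ1, hJ2⟩ := exists_two_pow_ge (show 1 ≤ 2 * N by linarith)
  have hJ : (J : ℝ) ≤ 2 * C' * N ^ (δ / 2) := by
    have := hlog (2 * N) N hN (by linarith) le_rfl
    linarith
  set F : ℕ → ℂ := fun x => ∑ y ∈ Finset.Icc 1 ⌊N₂⌋₊, u x * w y * cutPhase γ β M N₁ N₂ ϑ t x y
    with hF
  have hext : ∑ x ∈ Finset.Icc 1 ⌊N₂⌋₊, F x = ∑ x ∈ Finset.Ico 1 (2 ^ J), F x := by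
    refine Finset.sum_subset (fun x hx => ?_) fun x hx hx' => ?_
    · rw [Finset.mem_Icc] at hx
      have h1 : (x : ℝ) ≤ N₂ := (Nat.le_floor_iff' (by omega)).mp hx.2
      have h2 : (x : ℝ) < 2 ^ J := by linarith
      exact Finset.mem_Ico.mpr ⟨hx.1, by exact_mod_cast h2⟩
    · refine Finset.sum_eq_zero fun y hy => ?_
      rw [cutPhase, if_neg, mul_zero]
      rintro ⟨⟨-, h⟩, -, -⟩
      apply hx'
      have hx1 := (Finset.mem_Ico.mp hx).1
      have hy1 : (1 : ℝ) ≤ y := by exact_mod_cast (Finset.mem_Icc.mp hy).1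
      have hx0 : (0 : ℝ) ≤ x := Nat.cast_nonneg x
      exact Finset.mem_Icc.mpr ⟨hx1, Nat.le_floor (by nlinarith)⟩
  set P : ℝ := M ^ ((1 : ℝ) / 14) * N₁ ^ (γ / 14 + 6 / 7) with hP
  set R : ℝ := N₁ ^ (13 / 12 - γ / 6) with hR
  have hP0 : 0 ≤ P := by positivity
  have hR0 : 0 ≤ R := by positivity
  have hP2 : M ^ ((1 : ℝ) / 7) * N₁ ^ (γ / 7 + 12 / 7) = P ^ 2 := by
    rw [hP, mul_pow, ← Real.rpow_natCast, ← Real.rpow_natCast, ← Real.rpow_mul hM0.le,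
      ← Real.rpow_mul hN₁0.le]
    congr 2 <;> push_cast <;> ring
  have hR2 : N₁ ^ (13 / 6 - γ / 3) = R ^ 2 := by
    rw [hR, ← Real.rpow_natCast, ← Real.rpow_mul hN₁0.le]
    congr 1
    push_cast
    ring
  have hNδ : N ^ δ = (N ^ (δ / 2)) ^ 2 := by
    rw [← Real.rpow_natCast, ← Real.rpow_mul hN0.le]
    congr 1
    push_cast
    ring
  have hb : ∀ j ∈ Finset.range J, ‖∑ x ∈ Finset.Ico (2 ^ j) (2 * 2 ^ j), F x‖ ≤
      √C * G ^ 2 * N ^ (δ / 2) * (P + R) := by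
    intro j _
    refine abs_le_of_sq_le_sq' ?_ (by positivity) |>.2
    refine (hblock β M N N₁ N₂ ϑ G t (2 ^ j) u w hN hM hMN hN₁ hN₂ hN₂N hϑ (by positivity)
      hu hw).trans ?_
    rw [hP2, hR2, hNδ]
    calc C * G ^ 4 * (N ^ (δ / 2)) ^ 2 * (P ^ 2 + R ^ 2)
        ≤ C * G ^ 4 * (N ^ (δ / 2)) ^ 2 * (P + R) ^ 2 := by
          gcongr
          nlinarith
      _ = √C ^ 2 * G ^ 4 * (N ^ (δ / 2)) ^ 2 * (P + R) ^ 2 := by rw [Real.sq_sqrt hC.le]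
      _ = _ := by ring
  rw [hext, sum_Ico_two_pow]
  calc _ ≤ J * (√C * G ^ 2 * N ^ (δ / 2) * (P + R)) := by
        refine (norm_sum_le_of_le _ hb).trans ?_
        rw [Finset.sum_const, Finset.card_range, nsmul_eq_mul]
    _ ≤ 2 * C' * N ^ (δ / 2) * (√C * G ^ 2 * N ^ (δ / 2) * (P + R)) := by gcongr
    _ = _ := by rw [hNδ]; ring

end DyadicSum

section Assembly

/-- Splitting the two-variable sum according to which of the variables is the larger one. -/
lemma sum_filter_eq_cutPhase (γ β M N₁ N₂ ϑ : ℝ) (K : ℕ) (a b : ℕ → ℂ) (p : ℕ × ℕ → Prop)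
    [DecidablePred p] (hp : ∀ x, p x ↔ ϑ < (x.1 : ℝ) ∧ ϑ < (x.2 : ℝ) ∧
      N₁ < ((x.1 * x.2 : ℕ) : ℝ) ∧ ((x.1 * x.2 : ℕ) : ℝ) ≤ N₂) :
    ∑ x ∈ (Finset.Icc 1 K ×ˢ Finset.Icc 1 K).filter p, a x.1 * b x.2 *
        e2pi (β * (x.1 : ℝ) ^ 2 * (x.2 : ℝ) ^ 2 - M * (x.1 : ℝ) ^ γ * (x.2 : ℝ) ^ γ) =
      ∑ x ∈ Finset.Icc 1 K, ∑ y ∈ Finset.Icc 1 K,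
        a x * b y * cutPhase γ β M N₁ N₂ ϑ 0 x y +
      ∑ x ∈ Finset.Icc 1 K, ∑ y ∈ Finset.Icc 1 K,
        b x * a y * cutPhase γ β M N₁ N₂ ϑ 1 x y := by
  rw [Finset.sum_filter, Finset.sum_product, Finset.sum_comm (f := fun x y => b x * a y * _),
    ← Finset.sum_add_distrib]
  refine Finset.sum_congr rfl fun x _ => ?_
  rw [← Finset.sum_add_distrib]
  refine Finset.sum_congr rfl fun y _ => ?_
  have hp' := hp (x, y)
  push_cast at hp'
  by_cases h : p (x, y)
  · obtain ⟨h1, h2, h3, h4⟩ := hp'.mp h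
    rw [if_pos h, cutPhase, cutPhase]
    rcases le_or_gt y x with hyx | hyx
    · rw [if_pos ⟨⟨h3, h4⟩, ⟨h1, h2⟩, hyx⟩, if_neg fun h' => by omega]
      ring
    · rw [if_neg fun h' => by omega,
        if_pos ⟨⟨by rwa [mul_comm], by rwa [mul_comm]⟩, ⟨h2, h1⟩, hyx⟩]
      ring_nf
  · rw [if_neg h, cutPhase, cutPhase, if_neg, if_neg]
    · ring
    · rintro ⟨⟨h1, h2⟩, ⟨h3, h4⟩, -⟩
      exact h (hp'.mpr ⟨h4, h3, by rwa [mul_comm], by rwa [mul_comm]⟩)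
    · rintro ⟨⟨h1, h2⟩, ⟨h3, h4⟩, -⟩
      exact h (hp'.mpr ⟨h3, h4, h1, h2⟩)

end Assembly

open Classical in
theorem Theta4_bound (γ ε : ℝ) (hγ1 : 13 / 14 < γ) (hγ2 : γ < 1) (hε : 0 < ε) :
    ∃ C > 0, ∀ (α : ℝ) (h : ℕ) (N : ℝ) (m : ℕ) (N₁ N₂ : ℝ) (a : ℕ → ℂ),
      0 < h → 2 ≤ N → 0 < m → (m : ℝ) ≤ N ^ ((16 - 15 * γ) / 29) / 2 →
      N₁ < N₂ → N₂ ≤ 2 * N₁ → N ^ ((30 * γ - 3) / (29 * γ)) < N₁ → N₁ ≤ N / 2 →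
      (∀ d : ℕ, ‖a d‖ ≤ (d.divisors.card : ℝ)) →
      ‖∑ x ∈ (Finset.Icc 1 ⌊N₂⌋₊ ×ˢ Finset.Icc 1 ⌊N₂⌋₊).filter
          (fun x : ℕ × ℕ => N ^ ((2 * γ + 23) / 58) < (x.1 : ℝ) ∧
            N ^ ((2 * γ + 23) / 58) < (x.2 : ℝ) ∧
            N₁ < ((x.1 * x.2 : ℕ) : ℝ) ∧ ((x.1 * x.2 : ℕ) : ℝ) ≤ N₂),
          a x.1 * ((ArithmeticFunction.vonMangoldt x.2 : ℝ) : ℂ) *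
            e2pi (α * (h : ℝ) * (x.1 : ℝ) ^ 2 * (x.2 : ℝ) ^ 2 -
              (m : ℝ) * (x.1 : ℝ) ^ γ * (x.2 : ℝ) ^ γ)‖ ≤
      C * (N₁ ^ ((1 : ℝ) / 2) * N ^ ((2 * γ + 23) / 58) +
        (N ^ ((16 - 15 * γ) / 29)) ^ ((1 : ℝ) / 14) * N₁ ^ (γ / 14 + 6 / 7)) * N ^ ε := by
  obtain ⟨C₁, hC₁, hsum⟩ := cutPhase_sum_bound γ (ε / 2) (by linarith) hγ2 (half_pos hε)
  have hη : 0 < ε / 4 := by positivity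
  obtain ⟨C₂, hC₂, hdiv⟩ := exists_card_divisors_le hη
  set A : ℝ := C₂ + 1 / (ε / 4) with hA
  have hA0 : 0 < A := by positivity
  refine ⟨2 * C₁ * A ^ 2, by positivity, ?_⟩
  intro α h N m N₁ N₂ a _ hN hm hmN _ hN₂ hN₁ hN₁N ha
  have hN0 : 0 < N := by linarith
  have hN1 : 1 ≤ N := by linarith
  have hm1 : (1 : ℝ) ≤ m := by exact_mod_cast hm
  have hγ0 : 0 < γ := by linarith
  set κ : ℝ := (30 * γ - 3) / (29 * γ) with hκ
  have hκ0 : 0 ≤ κ := div_nonneg (by linarith) (by linarith)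
  have hN₁1 : 1 ≤ N₁ := (Real.one_le_rpow hN1 hκ0).trans hN₁.le
  have hN₁0 : 0 < N₁ := by linarith
  have hN₂N : N₂ ≤ N := by linarith
  set μ : ℝ := N ^ ((16 - 15 * γ) / 29) with hμ
  have hμ0 : 0 < μ := by positivity
  have hmμ : (m : ℝ) ≤ μ := by linarith
  have hmN₁ : (m : ℝ) ≤ N₁ ^ (2 - γ) := by
    calc (m : ℝ) ≤ N ^ ((16 - 15 * γ) / 29) := hmμ
      _ ≤ N ^ (κ * (2 - γ)) := by
        refine Real.rpow_le_rpow_of_exponent_le hN1 ?_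
        rw [hκ, div_mul_eq_mul_div, div_le_div_iff₀ (by norm_num) (by positivity)]
        nlinarith
      _ = (N ^ κ) ^ (2 - γ) := Real.rpow_mul hN0.le _ _
      _ ≤ N₁ ^ (2 - γ) := Real.rpow_le_rpow (by positivity) hN₁.le (by linarith)
  set ϑ : ℝ := N ^ ((2 * γ + 23) / 58) with hϑ
  have hϑN : N ^ ((3 : ℝ) / 7) ≤ ϑ :=
    Real.rpow_le_rpow_of_exponent_le hN1 (by linarith)
  set K : ℕ := ⌊N₂⌋₊ with hK
  set G : ℝ := A * N ^ (ε / 4) with hG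
  have hG0 : 0 ≤ G := by positivity
  have hle : ∀ n ∈ Finset.Icc 1 K, n ≠ 0 ∧ (n : ℝ) ^ (ε / 4) ≤ N ^ (ε / 4) := by
    intro n hn
    rw [Finset.mem_Icc] at hn
    have h1 : n ≠ 0 := by omega
    have h2 : (n : ℝ) ≤ N := ((Nat.le_floor_iff' h1).mp hn.2).trans hN₂N
    exact ⟨h1, by gcongr⟩
  set u : ℕ → ℂ := fun n => if n ∈ Finset.Icc 1 K then a n else 0 with hu
  set w : ℕ → ℂ := fun n =>
    if n ∈ Finset.Icc 1 K then ((ArithmeticFunction.vonMangoldt n : ℝ) : ℂ) else 0 with hw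
  have huG : ∀ n, ‖u n‖ ≤ G := by
    intro n
    rw [hu]
    dsimp only
    split_ifs with hn
    · obtain ⟨h1, h2⟩ := hle n hn
      calc ‖a n‖ ≤ C₂ * (n : ℝ) ^ (ε / 4) := (ha n).trans (hdiv n h1)
        _ ≤ A * N ^ (ε / 4) := by
          gcongr
          rw [hA]
          exact le_add_of_nonneg_right (by positivity)
    · simpa using hG0
  have hwG : ∀ n, ‖w n‖ ≤ G := by
    intro n
    rw [hw]
    dsimp only
    split_ifs with hn
    · obtain ⟨h1, h2⟩ := hle n hn
      rw [Complex.norm_real, Real.norm_of_nonneg ArithmeticFunction.vonMangoldt_nonneg]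
      calc ArithmeticFunction.vonMangoldt n ≤ Real.log n :=
            ArithmeticFunction.vonMangoldt_le_log
        _ ≤ (n : ℝ) ^ (ε / 4) / (ε / 4) := Real.log_le_rpow_div (Nat.cast_nonneg n) hη
        _ = 1 / (ε / 4) * (n : ℝ) ^ (ε / 4) := by ring
        _ ≤ A * N ^ (ε / 4) := by
          gcongr
          rw [hA]
          exact le_add_of_nonneg_left hC₂.le
    · simpa using hG0
  have hcongr : ∀ p ∈ Finset.Icc 1 K ×ˢ Finset.Icc 1 K,
      a p.1 * ((ArithmeticFunction.vonMangoldt p.2 : ℝ) : ℂ) = u p.1 * w p.2 := by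
    intro p hp
    rw [Finset.mem_product] at hp
    simp only [hu, hw, if_pos hp.1, if_pos hp.2]
  rw [Finset.sum_congr rfl fun p hp => by rw [hcongr p (Finset.mem_filter.mp hp).1],
    sum_filter_eq_cutPhase γ (α * h) m N₁ N₂ ϑ K u w _ fun p => Iff.rfl]
  have hb1 := hsum (α * h) m N N₁ N₂ ϑ G 0 u w hN1 hm1 hmN₁ hN₁1 hN₂ hN₂N hϑN huG hwG
  have hb2 := hsum (α * h) m N N₁ N₂ ϑ G 1 w u hN1 hm1 hmN₁ hN₁1 hN₂ hN₂N hϑN hwG huG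
  have hR : N₁ ^ (13 / 12 - γ / 6) ≤ N₁ ^ ((1 : ℝ) / 2) * ϑ := by
    rw [show 13 / 12 - γ / 6 = 1 / 2 + (7 / 12 - γ / 6) by ring, Real.rpow_add hN₁0]
    gcongr
    calc N₁ ^ (7 / 12 - γ / 6) ≤ N ^ (7 / 12 - γ / 6) :=
          Real.rpow_le_rpow hN₁0.le (by linarith) (by linarith)
      _ ≤ ϑ := Real.rpow_le_rpow_of_exponent_le hN1 (by linarith)
  have hGN : G ^ 2 * N ^ (ε / 2) = A ^ 2 * N ^ ε := by
    rw [hG, mul_pow, ← Real.rpow_natCast (N ^ (ε / 4)), ← Real.rpow_mul hN0.le, mul_assoc,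
      ← Real.rpow_add hN0]
    congr 2
    push_cast
    ring
  refine (norm_add_le _ _).trans ((add_le_add hb1 hb2).trans ?_)
  calc _ = 2 * C₁ * (G ^ 2 * N ^ (ε / 2)) *
        ((m : ℝ) ^ ((1 : ℝ) / 14) * N₁ ^ (γ / 14 + 6 / 7) + N₁ ^ (13 / 12 - γ / 6)) := by ring
    _ ≤ 2 * C₁ * (G ^ 2 * N ^ (ε / 2)) *
        (μ ^ ((1 : ℝ) / 14) * N₁ ^ (γ / 14 + 6 / 7) + N₁ ^ ((1 : ℝ) / 2) * ϑ) := by gcongr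
    _ = _ := by rw [hGN]; ring
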